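/- arXiv:1411.3276 — 14 statements merged into one kernel-verified Lean document; each statement's English description precedes it below -/
import Mathlib

section
/- Let ρ : ℝⁿ → GL(n,ℝ) be a moving frame with structure functions C^k_{ij}, and let X : ℝⁿ → ℝⁿ be a smooth vector field with frame components X̃ : ℝⁿ → ℝⁿ defined by X(q) = ρ(q)X̃(q), i.e. X = X̃^j Y_j. Let Ψ : ℝⁿ × ℝⁿ → ℝⁿ × ℝⁿ be the diffeomorphism Ψ(q,y) = (q, ρ(q)y). Then the pullback of the complete lift X^c(q,v) = (X(q), DX(q)v) under Ψ is the vector field on ℝⁿ × ℝⁿ whose value at (q,y) has i-th first-slot component Σ_j X̃^j(q)ρ^i_j(q) and k-th second-slot component Σ_j (Σ_i ρ^i_j(q) ∂X̃^k/∂q^i(q) − Σ_i C^k_{ij}(q) X̃^i(q)) y^j. -/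
theorem fderiv_mulVec_apply {ι κ E : Type*} [Fintype ι] [Fintype κ]
    [NormedAddCommGroup E] [NormedSpace ℝ E] {M : E → ι → κ → ℝ} {u : E → κ → ℝ} {x : E}
    (hM : DifferentiableAt ℝ M x) (hu : DifferentiableAt ℝ u x) (v : E) (i : ι) :
    fderiv ℝ (fun x' => fun i => ∑ j, M x' i j * u x' j) x v i =
      ∑ j, (fderiv ℝ M x v i j * u x j + M x i j * fderiv ℝ u x v j) := by
  have hM' (i : ι) (j : κ) := hasFDerivAt_pi'.1 (hasFDerivAt_pi'.1 hM.hasFDerivAt i) j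
  have hu' (j : κ) := hasFDerivAt_pi'.1 hu.hasFDerivAt j
  have key : HasFDerivAt (fun x' => fun i => ∑ j, M x' i j * u x' j) _ x :=
    hasFDerivAt_pi.2 fun i => HasFDerivAt.fun_sum (u := Finset.univ) fun j _ =>
      (hM' i j).mul (hu' j)
  rw [key.fderiv]
  simp only [ContinuousLinearMap.pi_apply, sum_apply,
    add_apply, smul_apply,
    ContinuousLinearMap.comp_apply, ContinuousLinearMap.proj_apply, smul_eq_mul]
  exact Finset.sum_congr rfl fun j _ => by ring

theorem fderiv_column_apply {ι κ E : Type*} [Fintype ι] [Fintype κ]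
    [NormedAddCommGroup E] [NormedSpace ℝ E] {M : E → ι → κ → ℝ} {x : E}
    (hM : DifferentiableAt ℝ M x) (v : E) (j : κ) (i : ι) :
    fderiv ℝ (fun x' => fun i => M x' i j) x v i = fderiv ℝ M x v i j := by
  have key : HasFDerivAt (fun x' => fun i => M x' i j) _ x :=
    hasFDerivAt_pi.2 fun i => hasFDerivAt_pi'.1 (hasFDerivAt_pi'.1 hM.hasFDerivAt i) j
  rw [key.fderiv]
  rfl

theorem ContinuousLinearMap.isInvertible_of_injective {E : Type*} [NormedAddCommGroup E]
    [NormedSpace ℝ E] [FiniteDimensional ℝ E] {T : E →L[ℝ] E} (hT : Function.Injective T) :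
    T.IsInvertible :=
  ⟨(LinearEquiv.ofInjectiveEndo (T : E →ₗ[ℝ] E) hT).toContinuousLinearEquiv, rfl⟩

/-- The derivative of the frame diffeomorphism `(q, y) ↦ (q, ρ(q) y)`. -/
theorem fderiv_frame_apply {n : ℕ} {ρ : (Fin n → ℝ) → Fin n → Fin n → ℝ}
    (hρ : Differentiable ℝ ρ) (q y a b : Fin n → ℝ) :
    fderiv ℝ (fun p : (Fin n → ℝ) × (Fin n → ℝ) => (p.1, fun i => ∑ j, ρ p.1 i j * p.2 j))
        (q, y) (a, b) =
      (a, fun i => ∑ j, (fderiv ℝ ρ q a i j * y j + ρ q i j * b j)) := by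
  have hρ₁ : HasFDerivAt (fun p : (Fin n → ℝ) × (Fin n → ℝ) => ρ p.1)
      ((fderiv ℝ ρ q).comp (ContinuousLinearMap.fst ℝ _ _)) (q, y) :=
    (hρ q).hasFDerivAt.comp (q, y) hasFDerivAt_fst
  have hdiff : DifferentiableAt ℝ (fun p : (Fin n → ℝ) × (Fin n → ℝ) =>
      fun i => ∑ j, ρ p.1 i j * p.2 j) (q, y) := by
    fun_prop
  rw [DifferentiableAt.fderiv_prodMk differentiableAt_fst hdiff]
  refine Prod.ext ?_ (funext fun i => ?_)
  · simp [fderiv_fst]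
  · simp only [ContinuousLinearMap.prod_apply]
    rw [fderiv_mulVec_apply hρ₁.differentiableAt differentiableAt_snd, hρ₁.fderiv, fderiv_snd]
    rfl

theorem isInvertible_fderiv_frame {n : ℕ} {ρ : (Fin n → ℝ) → Fin n → Fin n → ℝ}
    (hρ : Differentiable ℝ ρ) {q : Fin n → ℝ} (hq : (Matrix.of (ρ q)).det ≠ 0)
    (y : Fin n → ℝ) :
    (fderiv ℝ (fun p : (Fin n → ℝ) × (Fin n → ℝ) => (p.1, fun i => ∑ j, ρ p.1 i j * p.2 j))
      (q, y)).IsInvertible := by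
  refine ContinuousLinearMap.isInvertible_of_injective
    ((injective_iff_map_eq_zero _).2 ?_)
  rintro ⟨a, b⟩ h
  rw [fderiv_frame_apply hρ, Prod.mk_eq_zero] at h
  obtain ⟨rfl, h⟩ := h
  have hb : b = 0 := Matrix.eq_zero_of_mulVec_eq_zero hq <| funext fun i => by
    simpa [Matrix.mulVec, dotProduct] using congrFun h i
  rw [hb, Prod.mk_zero_zero]

/-- In a moving frame `ρ : ℝⁿ → GL(n,ℝ)` with structure functions `C^k_{ij}`
(defined by `[Y_i, Y_j] = C^k_{ij} Y_k` where `Y_j(q) = ρ(q) e_j`), the pullback of the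
complete lift `X^c(q,v) = (X q, DX(q)v)` of `X = X̃^j Y_j` under the frame
diffeomorphism `Ψ(q,y) = (q, ρ(q)y)` is the vector field with components
`(Σ_j X̃^j ρ^i_j, Σ_j (Σ_i ρ^i_j ∂X̃^k/∂q^i − Σ_i C^k_{ij} X̃^i) y^j)`. -/
theorem complete_lift_in_moving_frame (n : ℕ)
    (ρ : (Fin n → ℝ) → Fin n → Fin n → ℝ) (hρ : ContDiff ℝ (⊤ : ℕ∞) ρ)
    (hinv : ∀ q : Fin n → ℝ, (Matrix.of (ρ q)).det ≠ 0)
    (C : Fin n → Fin n → Fin n → (Fin n → ℝ) → ℝ)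
    (hC : ∀ (i j : Fin n) (q : Fin n → ℝ) (a : Fin n),
      fderiv ℝ (fun q' : Fin n → ℝ => fun b => ρ q' b j) q (fun b => ρ q b i) a -
        fderiv ℝ (fun q' : Fin n → ℝ => fun b => ρ q' b i) q (fun b => ρ q b j) a =
        ∑ k, C k i j q * ρ q a k)
    (Xtil : (Fin n → ℝ) → (Fin n → ℝ)) (hXtil : ContDiff ℝ (⊤ : ℕ∞) Xtil) :
    ∀ (q y : Fin n → ℝ),
      (fderiv ℝ
          (fun p : (Fin n → ℝ) × (Fin n → ℝ) =>
            (p.1, fun i => ∑ j, ρ p.1 i j * p.2 j)) (q, y)).inverse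
        ((fun i => ∑ j, ρ q i j * Xtil q j),
          fderiv ℝ (fun q' : Fin n → ℝ => fun i => ∑ j, ρ q' i j * Xtil q' j) q
            (fun i => ∑ j, ρ q i j * y j)) =
      ((fun i => ∑ j, Xtil q j * ρ q i j),
        (fun k => ∑ j,
          ((∑ i, ρ q i j * fderiv ℝ Xtil q (Pi.single i 1) k) -
            ∑ i, C k i j q * Xtil q i) * y j)) := by
  intro q y
  have hρd : Differentiable ℝ ρ := hρ.differentiable (by simp)
  have hXd : Differentiable ℝ Xtil := hXtil.differentiable (by simp)
  rw [(isInvertible_fderiv_frame hρd (hinv q) y).inverse_apply_eq, fderiv_frame_apply hρd]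
  refine Prod.ext (by simp only [mul_comm]) (funext fun a => ?_)
  dsimp only
  rw [fderiv_mulVec_apply (hρd q) (hXd q)]
  simp only [fderiv_column_apply (hρd _)] at hC
  have hcomb (L : (Fin n → ℝ) →L[ℝ] (Fin n → Fin n → ℝ)) (u : Fin n → ℝ) (c : Fin n) :
      L (fun i => ∑ j, ρ q i j * u j) a c = ∑ j, L (fun i => ρ q i j) a c * u j := by
    have : (fun i => ∑ j, ρ q i j * u j) = ∑ j, u j • fun i => ρ q i j := by
      ext i; simp [mul_comm]
    simp [this, mul_comm]
  have hX (k : Fin n) : fderiv ℝ Xtil q (fun i => ∑ j, ρ q i j * y j) k =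
      ∑ j, (∑ i, ρ q i j * fderiv ℝ Xtil q (Pi.single i 1) k) * y j := by
    have : (fun i => ∑ j, ρ q i j * y j) =
        ∑ j, y j • ∑ i, ρ q i j • (Pi.single i 1 : Fin n → ℝ) := by
      ext i; simp [Pi.single_apply, mul_comm]
    simp [this, mul_comm]
  have hbracket : (∑ j, ∑ i, fderiv ℝ ρ q (fun b => ρ q b i) a j * Xtil q i * y j) -
      ∑ j, ∑ i, fderiv ℝ ρ q (fun b => ρ q b j) a i * Xtil q i * y j =
      ∑ k, ρ q a k * ∑ j, (∑ i, C k i j q * Xtil q i) * y j := by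
    simp only [← Finset.sum_sub_distrib, ← sub_mul, hC]
    simp only [Finset.mul_sum, Finset.sum_mul]
    conv_rhs => rw [Finset.sum_comm]
    refine Finset.sum_congr rfl fun j _ => ?_
    rw [Finset.sum_comm]
    exact Finset.sum_congr rfl fun k _ => Finset.sum_congr rfl fun i _ => by ring
  simp only [Finset.sum_add_distrib, hX, sub_mul, Finset.sum_sub_distrib, mul_sub, ← hbracket]
  have hX' : (fun i => ∑ j, Xtil q j * ρ q i j) = fun i => ∑ j, ρ q i j * Xtil q j := by
    simp only [mul_comm]
  rw [hX']
  simp only [hcomb, Finset.sum_mul]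
  rw [Finset.sum_comm (f := fun j i => fderiv ℝ ρ q (fun b => ρ q b j) a i * Xtil q i * y j)]
  simp only [mul_right_comm _ (y _) (Xtil q _)]
  ring
end

section
/- Let ρ : ℝⁿ → GL(n,ℝ) be a moving frame with structure functions C^k_{ij}. Let t ↦ (q(t), y(t)) be a smooth curve in ℝⁿ × ℝⁿ with q̇(t) = ρ(q(t))y(t), let μ_i, μ̃_i : ℝⁿ × ℝⁿ → ℝ (1 ≤ i ≤ n) be smooth, and let X̃ : ℝ × ℝⁿ → ℝⁿ be a smooth time-dependent frame-component function. Then for all t, d/dt[Σ_i μ̃_i(q(t),y(t)) X̃^i(t,q(t))] − ⟨μ(q(t),y(t)), X^T(t,q(t),y(t))⟩ = Σ_i X̃^i(t,q(t)) [ d/dt μ̃_i(q(t),y(t)) − Σ_j ρ^j_i(q(t)) μ_j(q(t),y(t)) + Σ_{j,k} C^k_{ij}(q(t)) y^j(t) μ̃_k(q(t),y(t)) ], where ⟨μ(q,y), (w₁,w₂)⟩ = Σ_i μ_i(q,y)w₁^i + Σ_i μ̃_i(q,y)w₂^i and X^T is the frame-coordinate tangent lift X^T(t,q,y) = ( Σ_j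 X̃^j ρ^i_j , ∂X̃^k/∂t + Σ_j(Σ_i ρ^i_j ∂X̃^k/∂q^i − Σ_i C^k_{ij}X̃^i) y^j ). -/
/-- Chain rule for a map `f (s, q s)`, with the spatial part of the derivative expanded in the
standard basis. -/
theorem hasDerivAt_comp_curve {n : ℕ} {F : Type*} [NormedAddCommGroup F] [NormedSpace ℝ F]
    {f : ℝ × (Fin n → ℝ) → F} {q : ℝ → Fin n → ℝ} {v : Fin n → ℝ} {t : ℝ}
    (hf : DifferentiableAt ℝ f (t, q t)) (hq : HasDerivAt q v t) :
    HasDerivAt (fun s => f (s, q s))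
      (fderiv ℝ f (t, q t) (1, 0) + ∑ i, v i • fderiv ℝ f (t, q t) (0, Pi.single i 1)) t := by
  have h := hf.hasFDerivAt.comp_hasDerivAt t ((hasDerivAt_id t).prodMk hq)
  have hv : ((1 : ℝ), v) = (1, 0) + ∑ i, v i • ((0 : ℝ), Pi.single i (1 : ℝ)) := by
    refine Prod.ext (by simp [Prod.fst_sum]) (funext fun a => ?_)
    simp [Prod.snd_sum, Finset.sum_apply, Pi.single_apply]
  rw [hv, map_add, map_sum] at h
  simp only [map_smul] at h
  exact h


/-- Along an admissible curve `q̇ = ρ(q)y` in frame coordinates, for any 1-form with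
components `(μ_i, μ̃_i)` and any time-dependent frame-component field `X̃`,
`d/dt⟨μ, X^V⟩ − ⟨μ, X^T⟩ = Σ_i X̃^i (dμ̃_i/dt − ρ^j_i μ_j + C^k_{ij} y^j μ̃_k)`. -/
theorem euler_lagrange_operator_in_moving_frame (n : ℕ)
    (ρ : (Fin n → ℝ) → Fin n → Fin n → ℝ) (hρ : ContDiff ℝ (⊤ : ℕ∞) ρ)
    (hinv : ∀ x : Fin n → ℝ, (Matrix.of (ρ x)).det ≠ 0)
    (C : Fin n → Fin n → Fin n → (Fin n → ℝ) → ℝ)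
    (hC : ∀ (i j : Fin n) (x : Fin n → ℝ) (a : Fin n),
      fderiv ℝ (fun x' : Fin n → ℝ => fun b => ρ x' b j) x (fun b => ρ x b i) a -
        fderiv ℝ (fun x' : Fin n → ℝ => fun b => ρ x' b i) x (fun b => ρ x b j) a =
        ∑ k, C k i j x * ρ x a k)
    (q y : ℝ → Fin n → ℝ) (hq : ContDiff ℝ (⊤ : ℕ∞) q) (hy : ContDiff ℝ (⊤ : ℕ∞) y)
    (hadm : ∀ t i, deriv q t i = ∑ j, ρ (q t) i j * y t j)
    (μ μt : ((Fin n → ℝ) × (Fin n → ℝ)) → Fin n → ℝ)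
    (hμ : ContDiff ℝ (⊤ : ℕ∞) μ) (hμt : ContDiff ℝ (⊤ : ℕ∞) μt)
    (Xtil : (ℝ × (Fin n → ℝ)) → Fin n → ℝ) (hXtil : ContDiff ℝ (⊤ : ℕ∞) Xtil) :
    ∀ t : ℝ,
      deriv (fun s => ∑ i, μt (q s, y s) i * Xtil (s, q s) i) t -
        ((∑ i, μ (q t, y t) i * ∑ j, Xtil (t, q t) j * ρ (q t) i j) +
          ∑ k, μt (q t, y t) k *
            (fderiv ℝ Xtil (t, q t) (1, 0) k +
              ∑ j, ((∑ i, ρ (q t) i j * fderiv ℝ Xtil (t, q t) (0, Pi.single i 1) k) -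
                ∑ i, C k i j (q t) * Xtil (t, q t) i) * y t j)) =
      ∑ i, Xtil (t, q t) i *
        (deriv (fun s => μt (q s, y s) i) t -
          (∑ j, ρ (q t) j i * μ (q t, y t) j) +
          ∑ j, ∑ k, C k i j (q t) * y t j * μt (q t, y t) k) := by
  intro t
  have hqt : HasDerivAt q (fun i => ∑ j, ρ (q t) i j * y t j) t := by
    have h := (hq.differentiable (by simp) t).hasDerivAt
    rwa [show deriv q t = fun i => ∑ j, ρ (q t) i j * y t j from funext (hadm t)] at h
  have hX (k : Fin n) := hasDerivAt_pi.1
    (hasDerivAt_comp_curve (hXtil.differentiable (by simp) (t, q t)) hqt) k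
  have hM (k : Fin n) : HasDerivAt (fun s => μt (q s, y s) k)
      (deriv (fun s => μt (q s, y s) k) t) t := by
    have h : ContDiff ℝ (⊤ : ℕ∞) (fun s => μt (q s, y s)) := hμt.comp (hq.prodMk hy)
    exact ((contDiff_pi.1 h k).differentiable (by simp) t).hasDerivAt
  rw [(HasDerivAt.fun_sum fun k _ => (hM k).fun_mul (hX k)).deriv]
  have hρμ : ∑ i, μ (q t, y t) i * ∑ j, Xtil (t, q t) j * ρ (q t) i j =
      ∑ i, Xtil (t, q t) i * ∑ j, ρ (q t) j i * μ (q t, y t) j := by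
    simp only [Finset.mul_sum]
    rw [Finset.sum_comm]
    exact Finset.sum_congr rfl fun i _ => Finset.sum_congr rfl fun j _ => by ring
  have hCμ : ∑ k, μt (q t, y t) k * ∑ j, (∑ i, C k i j (q t) * Xtil (t, q t) i) * y t j =
      ∑ i, Xtil (t, q t) i * ∑ j, ∑ k, C k i j (q t) * y t j * μt (q t, y t) k := by
    simp only [Finset.mul_sum, Finset.sum_mul]
    rw [Finset.sum_comm, Finset.sum_congr rfl fun j _ => Finset.sum_comm, Finset.sum_comm]
    exact Finset.sum_congr rfl fun i _ => Finset.sum_congr rfl fun j _ =>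
      Finset.sum_congr rfl fun k _ => by ring
  have hDX (k : Fin n) :
      ∑ j, (∑ i, ρ (q t) i j * fderiv ℝ Xtil (t, q t) (0, Pi.single i 1) k) * y t j =
        ∑ i, (∑ j, ρ (q t) i j * y t j) * fderiv ℝ Xtil (t, q t) (0, Pi.single i 1) k := by
    simp only [Finset.sum_mul]
    rw [Finset.sum_comm]
    exact Finset.sum_congr rfl fun i _ => Finset.sum_congr rfl fun j _ => by ring
  simp only [sub_mul, Finset.sum_sub_distrib, hDX, mul_add, mul_sub, Finset.sum_add_distrib,
    hρμ, hCμ, Pi.add_apply, Finset.sum_apply, Pi.smul_apply, smul_eq_mul]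
  rw [Finset.sum_congr rfl fun k _ => mul_comm (deriv (fun s => μt (q s, y s) k) t) _]
  ring
end

section
/- Let L : ℝⁿ × ℝⁿ → ℝ be smooth, let t₀ < t₁, and let σ : [t₀,t₁] → ℝⁿ be smooth. Then the following are equivalent: (a) for every smooth time-dependent vector field X : ℝ × ℝⁿ → ℝⁿ with X(t₀,σ(t₀)) = 0 and X(t₁,σ(t₁)) = 0, ∫_{t₀}^{t₁} [ D₁L(σ(t),σ'(t))(X(t,σ(t))) + D₂L(σ(t),σ'(t))(∂X/∂t(t,σ(t)) + D_qX(t,σ(t))σ'(t)) ] dt = 0; (b) σ satisfies the Euler–Lagrange equations: for all t ∈ [t₀,t₁], d/dt[D₂L(σ(t),σ'(t))] = D₁L(σ(t),σ'(t)) as linear functionals on ℝⁿ. -/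
open Set

/-- A continuous function whose square has zero integral against the weight `(t - a) * (b - t)`
vanishes on `[a, b]`. -/
theorem eqOn_zero_of_integral_weighted_sq_eq_zero {a b : ℝ} (hab : a < b) {e : ℝ → ℝ}
    (he : Continuous e) (hint : ∫ t in a..b, (t - a) * (b - t) * e t * e t = 0) :
    EqOn e 0 (Icc a b) := by
  have hIoo : EqOn e 0 (Ioo a b) := by
    intro t ht
    by_contra hne
    have hpos : 0 < ∫ t in a..b, (t - a) * (b - t) * e t * e t := by
      refine intervalIntegral.integral_pos hab (by fun_prop) (fun s hs => ?_)
        ⟨t, Ioo_subset_Icc_self ht, ?_⟩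
      · rw [mul_assoc]
        exact mul_nonneg (mul_nonneg (by linarith [hs.1]) (by linarith [hs.2]))
          (mul_self_nonneg _)
      · rw [mul_assoc]
        exact mul_pos (mul_pos (by linarith [ht.1]) (by linarith [ht.2]))
          (mul_self_pos.2 hne)
    exact hpos.ne' hint
  have h := hIoo.closure he continuous_const
  rwa [closure_Ioo hab.ne] at h

section MomentumCurve

variable {E F : Type*} [NormedAddCommGroup E] [NormedSpace ℝ E]
  [NormedAddCommGroup F] [NormedSpace ℝ F]

/-- Leibniz rule for the pairing of a curve of covectors on `E × F` with a curve in `F`. -/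
theorem HasDerivAt.clm_apply_zero_prodMk {P : ℝ → (E × F) →L[ℝ] ℝ} {P' : (E × F) →L[ℝ] ℝ}
    {Y : ℝ → F} {Y' : F} {t : ℝ} (hP : HasDerivAt P P' t) (hY : HasDerivAt Y Y' t) :
    HasDerivAt (fun s => P s (0, Y s)) (P' (0, Y t) + P t (0, Y')) t :=
  hP.clm_apply ((hasDerivAt_const t (0 : E)).prodMk hY)

/-- Integration by parts for the first variation along a curve vanishing at the endpoints. -/
theorem integral_first_variation {P : ℝ → (E × E) →L[ℝ] ℝ} (hP : ContDiff ℝ 1 P)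
    {Y : ℝ → E} (hY : ContDiff ℝ 1 Y) {a b : ℝ} (ha : Y a = 0) (hb : Y b = 0) :
    ∫ t in a..b, (P t (Y t, 0) + P t (0, deriv Y t)) =
      ∫ t in a..b, (P t (Y t, 0) - deriv P t (0, Y t)) := by
  have hPc := hP.continuous
  have hYc := hY.continuous
  have hP'c := hP.continuous_deriv le_rfl
  have hY'c := hY.continuous_deriv le_rfl
  have htotal : ∫ t in a..b, (deriv P t (0, Y t) + P t (0, deriv Y t)) = 0 := by
    rw [intervalIntegral.integral_eq_sub_of_hasDerivAt
      (f := fun t => P t (0, Y t)) (fun t _ =>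
        (hP.differentiable one_ne_zero t).hasDerivAt.clm_apply_zero_prodMk
          (hY.differentiable one_ne_zero t).hasDerivAt)
      (Continuous.intervalIntegrable (by fun_prop) _ _)]
    simp [ha, hb, Prod.mk_zero_zero]
  rw [← sub_eq_zero, ← intervalIntegral.integral_sub
    (Continuous.intervalIntegrable (by fun_prop) _ _)
    (Continuous.intervalIntegrable (by fun_prop) _ _), ← htotal]
  congr 1
  ext t
  ring

end MomentumCurve


/-- Hamilton's principle in the form of generalized variational calculus:
`∫ ⟨dL(σ,σ'), X^T⟩ dt = 0` for all time-dependent vector fields `X` vanishing at the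
endpoints iff `σ` satisfies the Euler–Lagrange equations
`d/dt (D₂L(σ,σ')) = D₁L(σ,σ')`. -/
theorem generalized_variational_iff_euler_lagrange (n : ℕ)
    (L : ((Fin n → ℝ) × (Fin n → ℝ)) → ℝ) (hL : ContDiff ℝ (⊤ : ℕ∞) L)
    (t₀ t₁ : ℝ) (ht : t₀ < t₁)
    (σ : ℝ → Fin n → ℝ) (hσ : ContDiff ℝ (⊤ : ℕ∞) σ) :
    (∀ X : (ℝ × (Fin n → ℝ)) → (Fin n → ℝ), ContDiff ℝ (⊤ : ℕ∞) X →
        X (t₀, σ t₀) = 0 → X (t₁, σ t₁) = 0 →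
        ∫ t in t₀..t₁,
          (fderiv ℝ L (σ t, deriv σ t) (X (t, σ t), 0) +
            fderiv ℝ L (σ t, deriv σ t)
              (0, fderiv ℝ X (t, σ t) (1, 0) + fderiv ℝ X (t, σ t) (0, deriv σ t))) = 0) ↔
      (∀ t ∈ Set.Icc t₀ t₁, ∀ w : Fin n → ℝ,
        deriv (fun s => fderiv ℝ L (σ s, deriv σ s) (0, w)) t =
          fderiv ℝ L (σ t, deriv σ t) (w, 0)) := by
  have hσ' : ContDiff ℝ (⊤ : ℕ∞) (deriv σ) := (contDiff_infty_iff_deriv.1 hσ).2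
  set P : ℝ → ((Fin n → ℝ) × (Fin n → ℝ)) →L[ℝ] ℝ :=
    fun t => fderiv ℝ L (σ t, deriv σ t) with hPdef
  have hP : ContDiff ℝ (⊤ : ℕ∞) P :=
    (hL.fderiv_right (m := (⊤ : ℕ∞)) (by simp)).comp (hσ.prodMk hσ')
  have hP' : ContDiff ℝ (⊤ : ℕ∞) (deriv P) := (contDiff_infty_iff_deriv.1 hP).2
  have hP1 : ContDiff ℝ 1 P := hP.of_le (by exact_mod_cast le_top)
  have hmomentum (t : ℝ) (w : Fin n → ℝ) :
      deriv (fun s => fderiv ℝ L (σ s, deriv σ s) (0, w)) t = deriv P t (0, w) := by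
    have h := (hP1.differentiable one_ne_zero t).hasDerivAt.clm_apply_zero_prodMk
      (hasDerivAt_const t w)
    simpa [Prod.mk_zero_zero] using h.deriv
  have hvariation (X : (ℝ × (Fin n → ℝ)) → (Fin n → ℝ)) (hX : ContDiff ℝ (⊤ : ℕ∞) X)
      (h₀ : X (t₀, σ t₀) = 0) (h₁ : X (t₁, σ t₁) = 0) :
      ∫ t in t₀..t₁,
          (fderiv ℝ L (σ t, deriv σ t) (X (t, σ t), 0) +
            fderiv ℝ L (σ t, deriv σ t)
              (0, fderiv ℝ X (t, σ t) (1, 0) + fderiv ℝ X (t, σ t) (0, deriv σ t))) =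
        ∫ t in t₀..t₁, (P t (X (t, σ t), 0) - deriv P t (0, X (t, σ t))) := by
    have hY : ContDiff ℝ (⊤ : ℕ∞) (fun t => X (t, σ t)) := hX.comp (contDiff_id.prodMk hσ)
    rw [← integral_first_variation hP1 (hY.of_le (by exact_mod_cast le_top)) h₀ h₁]
    congr 1
    ext t
    have hXt := (hX.differentiable (by simp) (t, σ t)).hasFDerivAt
    have hσt := (hσ.differentiable (by simp) t).hasDerivAt
    have hYt : deriv (fun t => X (t, σ t)) t = fderiv ℝ X (t, σ t) (1, deriv σ t) :=
      (hXt.comp_hasDerivAt t ((hasDerivAt_id t).prodMk hσt)).deriv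
    rw [hYt, ← map_add (fderiv ℝ X (t, σ t)), Prod.mk_add_mk, add_zero, zero_add]
  constructor
  · intro hvar t ht' w
    set e : ℝ → ℝ := fun t => P t (w, 0) - deriv P t (0, w) with hedef
    have he : ContDiff ℝ (⊤ : ℕ∞) e :=
      (hP.clm_apply contDiff_const).sub (hP'.clm_apply contDiff_const)
    let X : (ℝ × (Fin n → ℝ)) → (Fin n → ℝ) :=
      fun z => ((z.1 - t₀) * (t₁ - z.1) * e z.1) • w
    have hX : ContDiff ℝ (⊤ : ℕ∞) X :=
      (((contDiff_fst.sub contDiff_const).mul (contDiff_const.sub contDiff_fst)).mul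
        (he.comp contDiff_fst)).smul contDiff_const
    have h₀ : X (t₀, σ t₀) = 0 := by simp [X]
    have h₁ : X (t₁, σ t₁) = 0 := by simp [X]
    have hint := hvar X hX h₀ h₁
    rw [hvariation X hX h₀ h₁] at hint
    have hzero := eqOn_zero_of_integral_weighted_sq_eq_zero ht he.continuous (by
      rw [← hint]
      congr 1
      ext s
      have hw₁ (c : ℝ) : ((c • w, 0) : (Fin n → ℝ) × (Fin n → ℝ)) = c • (w, 0) := by simp
      have hw₂ (c : ℝ) : ((0, c • w) : (Fin n → ℝ) × (Fin n → ℝ)) = c • (0, w) := by simp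
      simp only [X, hw₁, hw₂, map_smul, smul_eq_mul, ← mul_sub]
      rfl) ht'
    rw [hmomentum]
    exact (sub_eq_zero.1 hzero).symm
  · intro hEL X hX h₀ h₁
    rw [hvariation X hX h₀ h₁]
    refine intervalIntegral.integral_zero_ae (.of_forall fun t htm => ?_)
    rw [uIoc_of_le ht.le] at htm
    rw [← hmomentum, hEL t (Ioc_subset_Icc_self htm), sub_self]
end

section
/- Let L : ℝⁿ × ℝⁿ → ℝ be smooth, let ρ : ℝⁿ → GL(n,ℝ) be a moving frame with structure functions C^k_{ij}, and define L̃(q,y) = L(q, ρ(q)y). Let t₀ < t₁, let q : [t₀,t₁] → ℝⁿ be smooth and set y(t) = ρ(q(t))⁻¹ q'(t). Then q satisfies the Euler–Lagrange equations d/dt[D₂L(q(t),q'(t))] = D₁L(q(t),q'(t)) if and only if (q,y) satisfies the Hamel equations: for all t and all i, d/dt[∂L̃/∂y^i(q(t),y(t))] − Σ_j ρ^j_i(q(t)) ∂L̃/∂q^j(q(t),y(t)) + Σ_{j,k} C^k_{ij}(q(t)) y^j(t) ∂L̃/∂y^k(q(t),y(t)) = 0. -/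
section FrameCoordinates

variable {E ι : Type*} [NormedAddCommGroup E] [NormedSpace ℝ E] [Fintype ι]

/-- Chain rule for a Lagrangian written in the velocity coordinates of a frame `Y`. -/
theorem fderiv_comp_frame_apply {L : E × E → ℝ} {Y : ι → E → E} {x : E} {v : ι → ℝ}
    (hL : Differentiable ℝ L) (hY : ∀ b, Differentiable ℝ (Y b)) (w : E) (u : ι → ℝ) :
    fderiv ℝ (fun p : E × (ι → ℝ) => L (p.1, ∑ b, p.2 b • Y b p.1)) (x, v) (w, u) =
      fderiv ℝ L (x, ∑ b, v b • Y b x)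
        (w, ∑ b, (v b • fderiv ℝ (Y b) x w + u b • Y b x)) := by
  have hfst : HasFDerivAt (fun p : E × (ι → ℝ) => p.1)
      (ContinuousLinearMap.fst ℝ E (ι → ℝ)) (x, v) := hasFDerivAt_fst
  have hcoord (b : ι) : HasFDerivAt (fun p : E × (ι → ℝ) => p.2 b)
      ((ContinuousLinearMap.proj b).comp (ContinuousLinearMap.snd ℝ E (ι → ℝ))) (x, v) :=
    ((ContinuousLinearMap.proj (R := ℝ) (φ := fun _ : ι => ℝ) b).comp
      (ContinuousLinearMap.snd ℝ E (ι → ℝ))).hasFDerivAt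
  have hfield (b : ι) : HasFDerivAt (fun p : E × (ι → ℝ) => Y b p.1)
      ((fderiv ℝ (Y b) x).comp (ContinuousLinearMap.fst ℝ E (ι → ℝ))) (x, v) :=
    HasFDerivAt.comp (x, v) (hY b x).hasFDerivAt hfst
  have hvel := HasFDerivAt.fun_sum (u := Finset.univ)
    fun b (_ : b ∈ Finset.univ) => (hcoord b).smul (hfield b)
  have hcomp := HasFDerivAt.comp (x, v)
    (hL (x, ∑ b, v b • Y b x)).hasFDerivAt (hfst.prodMk hvel)
  have := congrArg (fun T => T (w, u)) hcomp.fderiv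
  simpa [Function.comp_def] using this

/-- The left-hand side of the `i`-th Hamel equation is the Euler–Lagrange covector evaluated
on the `i`-th frame field. -/
theorem hamel_eq_eulerLagrange_apply_frame [DecidableEq ι] {L : E × E → ℝ} {Y : ι → E → E}
    {C : ι → ι → ι → E → ℝ} {q : ℝ → E} {y : ℝ → ι → ℝ}
    (hL : ContDiff ℝ 2 L) (hY : ∀ b, Differentiable ℝ (Y b))
    (hC : ∀ i j x, fderiv ℝ (Y j) x (Y i x) - fderiv ℝ (Y i) x (Y j x) =
      ∑ k, C k i j x • Y k x)
    (hq : Differentiable ℝ q) (hq' : Differentiable ℝ (deriv q))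
    (hy : ∀ t, ∑ j, y t j • Y j (q t) = deriv q t) (t : ℝ) (i : ι) :
    deriv (fun s => fderiv ℝ (fun p : E × (ι → ℝ) => L (p.1, ∑ b, p.2 b • Y b p.1))
          (q s, y s) (0, Pi.single i 1)) t -
        fderiv ℝ (fun p : E × (ι → ℝ) => L (p.1, ∑ b, p.2 b • Y b p.1))
          (q t, y t) (Y i (q t), 0) +
        ∑ j, ∑ k, C k i j (q t) * y t j *
          fderiv ℝ (fun p : E × (ι → ℝ) => L (p.1, ∑ b, p.2 b • Y b p.1))
            (q t, y t) (0, Pi.single k 1) =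
      deriv (fun s => fderiv ℝ L (q s, deriv q s)) t (0, Y i (q t)) -
        fderiv ℝ L (q t, deriv q t) (Y i (q t), 0) := by
  have hL₁ : Differentiable ℝ L := hL.differentiable (by norm_num)
  have hvert (s : ℝ) (k : ι) :
      fderiv ℝ (fun p : E × (ι → ℝ) => L (p.1, ∑ b, p.2 b • Y b p.1))
        (q s, y s) (0, Pi.single k 1) = fderiv ℝ L (q s, deriv q s) (0, Y k (q s)) := by
    rw [fderiv_comp_frame_apply hL₁ hY, hy]
    simp [Pi.single_apply, ite_smul]
  have hmom : DifferentiableAt ℝ (fun s => fderiv ℝ L (q s, deriv q s)) t :=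
    DifferentiableAt.comp t
      (((hL.fderiv_right (m := 1) (by norm_num)).differentiable (by norm_num)) (q t, deriv q t))
      ((hq t).prodMk (hq' t))
  have hfield : HasDerivAt (fun s => ((0 : E), Y i (q s)))
      (0, fderiv ℝ (Y i) (q t) (deriv q t)) t :=
    (hasDerivAt_const t (0 : E)).prodMk
      (HasFDerivAt.comp_hasDerivAt t (hY i (q t)).hasFDerivAt (hq t).hasDerivAt)
  have hderiv := (hmom.hasDerivAt.clm_apply hfield).deriv
  have hbracket : fderiv ℝ (Y i) (q t) (deriv q t) -
      ∑ j, y t j • fderiv ℝ (Y j) (q t) (Y i (q t)) +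
      ∑ j, ∑ k, (C k i j (q t) * y t j) • Y k (q t) = 0 := by
    have hsum (j : ι) : ∑ k, (C k i j (q t) * y t j) • Y k (q t) =
        y t j • (fderiv ℝ (Y j) (q t) (Y i (q t)) - fderiv ℝ (Y i) (q t) (Y j (q t))) := by
      rw [hC, Finset.smul_sum]
      exact Finset.sum_congr rfl fun k _ => by rw [smul_smul, mul_comm]
    simp_rw [hsum, ← hy t, map_sum, map_smul, smul_sub, Finset.sum_sub_distrib]
    abel
  have happly := congrArg
    (fun z => (fderiv ℝ L (q t, deriv q t)).comp (ContinuousLinearMap.inr ℝ E E) z) hbracket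
  simp only [map_add, map_sub, map_zero, map_sum, map_smul, smul_eq_mul,
    ContinuousLinearMap.comp_apply, ContinuousLinearMap.inr_apply] at happly
  have hhor : fderiv ℝ (fun p : E × (ι → ℝ) => L (p.1, ∑ b, p.2 b • Y b p.1))
      (q t, y t) (Y i (q t), 0) = fderiv ℝ L (q t, deriv q t) (Y i (q t), 0) +
        ∑ j, y t j * fderiv ℝ L (q t, deriv q t) (0, fderiv ℝ (Y j) (q t) (Y i (q t))) := by
    rw [fderiv_comp_frame_apply hL₁ hY, hy]
    have hsplit : (Y i (q t), ∑ b, (y t b • fderiv ℝ (Y b) (q t) (Y i (q t)) +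
        (0 : ι → ℝ) b • Y b (q t))) = (Y i (q t), (0 : E)) +
        ContinuousLinearMap.inr ℝ E E
          (∑ b, y t b • fderiv ℝ (Y b) (q t) (Y i (q t))) := by
      simp only [ContinuousLinearMap.inr_apply, Prod.mk_add_mk, Pi.zero_apply, zero_smul,
        add_zero, zero_add]
    rw [hsplit]
    simp only [map_add, map_sum, map_smul, smul_eq_mul, ContinuousLinearMap.inr_apply]
  simp_rw [hvert]
  rw [hhor, hderiv]
  linarith

end FrameCoordinates

/-- A functional vanishes when it vanishes on the columns of an invertible matrix. -/
theorem LinearMap.eq_zero_of_apply_col_eq_zero {n : ℕ} {A : Fin n → Fin n → ℝ}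
    (hA : (Matrix.of A).det ≠ 0) (T : (Fin n → ℝ) →ₗ[ℝ] ℝ)
    (hT : ∀ i, T (fun a => A a i) = 0) : T = 0 := by
  refine LinearMap.ext fun w => ?_
  have hw : w = ∑ i, ((Matrix.of A)⁻¹.mulVec w) i • fun a => A a i := by
    have h : (Matrix.of A).mulVec ((Matrix.of A)⁻¹.mulVec w) = w := by
      rw [Matrix.mulVec_mulVec, Matrix.mul_nonsing_inv _ hA.isUnit, Matrix.one_mulVec]
    conv_lhs => rw [← h]
    ext a
    simp [Matrix.mulVec, dotProduct, mul_comm]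
  rw [hw, map_sum]
  simp [hT]


/-- A curve satisfies the Euler–Lagrange equations for `L` iff, in the coordinates
`(q, y)` induced by a moving frame `ρ` (with `q̇ = ρ(q)y` and `L̃(q,y) = L(q, ρ(q)y)`),
it satisfies the Hamel equations
`d/dt(∂L̃/∂y^i) − ρ^j_i ∂L̃/∂q^j + C^k_{ij} y^j ∂L̃/∂y^k = 0`. -/
theorem euler_lagrange_iff_hamel (n : ℕ)
    (L : ((Fin n → ℝ) × (Fin n → ℝ)) → ℝ) (hL : ContDiff ℝ (⊤ : ℕ∞) L)
    (ρ : (Fin n → ℝ) → Fin n → Fin n → ℝ) (hρ : ContDiff ℝ (⊤ : ℕ∞) ρ)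
    (hinv : ∀ x : Fin n → ℝ, (Matrix.of (ρ x)).det ≠ 0)
    (C : Fin n → Fin n → Fin n → (Fin n → ℝ) → ℝ)
    (hC : ∀ (i j : Fin n) (x : Fin n → ℝ) (a : Fin n),
      fderiv ℝ (fun x' : Fin n → ℝ => fun b => ρ x' b j) x (fun b => ρ x b i) a -
        fderiv ℝ (fun x' : Fin n → ℝ => fun b => ρ x' b i) x (fun b => ρ x b j) a =
        ∑ k, C k i j x * ρ x a k)
    (t₀ t₁ : ℝ) (ht : t₀ < t₁)
    (q : ℝ → Fin n → ℝ) (hq : ContDiff ℝ (⊤ : ℕ∞) q)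
    (y : ℝ → Fin n → ℝ)
    (hy : ∀ t i, ∑ j, ρ (q t) i j * y t j = deriv q t i) :
    (∀ t ∈ Set.Icc t₀ t₁, ∀ w : Fin n → ℝ,
        deriv (fun s => fderiv ℝ L (q s, deriv q s) (0, w)) t =
          fderiv ℝ L (q t, deriv q t) (w, 0)) ↔
      (∀ t ∈ Set.Icc t₀ t₁, ∀ i : Fin n,
        deriv (fun s =>
            fderiv ℝ (fun p : (Fin n → ℝ) × (Fin n → ℝ) =>
                L (p.1, fun a => ∑ b, ρ p.1 a b * p.2 b)) (q s, y s)
              (0, Pi.single i 1)) t -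
          (∑ j, ρ (q t) j i *
            fderiv ℝ (fun p : (Fin n → ℝ) × (Fin n → ℝ) =>
                L (p.1, fun a => ∑ b, ρ p.1 a b * p.2 b)) (q t, y t)
              (Pi.single j 1, 0)) +
          (∑ j, ∑ k, C k i j (q t) * y t j *
            fderiv ℝ (fun p : (Fin n → ℝ) × (Fin n → ℝ) =>
                L (p.1, fun a => ∑ b, ρ p.1 a b * p.2 b)) (q t, y t)
              (0, Pi.single k 1)) = 0) := by
  have hρ₁ : Differentiable ℝ ρ := hρ.differentiable (by simp)
  have hY (b : Fin n) : Differentiable ℝ (fun x a => ρ x a b) := by fun_prop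
  have hq₁ : Differentiable ℝ q := hq.differentiable (by simp)
  have hq₂ : Differentiable ℝ (deriv q) :=
    (contDiff_infty.1 hq 2).differentiable_deriv_two
  have hL₂ : ContDiff ℝ 2 L := contDiff_infty.1 hL 2
  have hvel (x v : Fin n → ℝ) : (fun a => ∑ b, ρ x a b * v b) =
      ∑ b, v b • fun a => ρ x a b := by
    ext a
    simp [mul_comm]
  have hmom (t : ℝ) : DifferentiableAt ℝ (fun s => fderiv ℝ L (q s, deriv q s)) t :=
    DifferentiableAt.comp t
      (((hL₂.fderiv_right (m := 1) (by norm_num)).differentiable (by norm_num)) (q t, deriv q t))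
      ((hq₁ t).prodMk (hq₂ t))
  have hEL (t : ℝ) (w : Fin n → ℝ) :
      deriv (fun s => fderiv ℝ L (q s, deriv q s) (0, w)) t =
        deriv (fun s => fderiv ℝ L (q s, deriv q s)) t (0, w) := by
    simpa using ((hmom t).hasDerivAt.clm_apply (hasDerivAt_const t ((0 : Fin n → ℝ), w))).deriv
  have hcontract (T : (Fin n → ℝ) × (Fin n → ℝ) →L[ℝ] ℝ) (w : Fin n → ℝ) :
      ∑ j, w j * T (Pi.single j 1, 0) = T (w, 0) := by
    have h := congrArg (T.comp (ContinuousLinearMap.inl ℝ _ _)) (pi_eq_sum_univ' w)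
    simp only [map_sum, map_smul, smul_eq_mul, ContinuousLinearMap.comp_apply,
      ContinuousLinearMap.inl_apply] at h
    exact h.symm
  have hhamel := hamel_eq_eulerLagrange_apply_frame (L := L) (Y := fun b x a => ρ x a b)
    (C := C) (y := y) hL₂ hY
    (fun i j x => by ext a; simpa using hC i j x a) hq₁ hq₂
    (fun t => by rw [← hvel]; exact funext (hy t))
  simp_rw [hvel, hcontract, hhamel, hEL]
  refine forall₂_congr fun t _ => ⟨fun h i => sub_eq_zero.2 (h _), fun h w => ?_⟩
  have hzero := LinearMap.eq_zero_of_apply_col_eq_zero (hinv (q t))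
    (((deriv (fun s => fderiv ℝ L (q s, deriv q s)) t).comp (ContinuousLinearMap.inr ℝ _ _) -
      (fderiv ℝ L (q t, deriv q t)).comp (ContinuousLinearMap.inl ℝ _ _) :
        (Fin n → ℝ) →L[ℝ] ℝ) : (Fin n → ℝ) →ₗ[ℝ] ℝ) (fun i => by simpa using h i)
  exact sub_eq_zero.1 (by simpa using LinearMap.congr_fun hzero w)
end

section
/- Let H : ℝⁿ × ℝⁿ → ℝ be smooth, let t₀ < t₁, and let q, p : [t₀,t₁] → ℝⁿ be smooth curves satisfying q'(t) = ∂H/∂p(q(t),p(t)) for all t. Then the following are equivalent: (a) for every smooth time-dependent vector field X : ℝ × ℝⁿ → ℝⁿ with X(t₀,q(t₀)) = 0 and X(t₁,q(t₁)) = 0, ∫_{t₀}^{t₁} [ −D₁H(q(t),p(t))(X(t,q(t))) + ⟨p(t), ∂X/∂t(t,q(t)) + D_qX(t,q(t))q'(t)⟩ ] dt = 0; (b) p'(t) = −∂H/∂q(q(t),p(t)) for all t ∈ [t₀,t₁]; that is, (q,p) satisfies Hamilton's equations for H. -/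
/-- The defect `ṗᵢ + ∂H/∂qᵢ` of the second Hamilton equation along the curve `(q, p)`. -/
noncomputable def hamiltonDefect {n : ℕ} (H : ((Fin n → ℝ) × (Fin n → ℝ)) → ℝ)
    (q p : ℝ → Fin n → ℝ) (t : ℝ) (i : Fin n) : ℝ :=
  deriv p t i + fderiv ℝ H (q t, p t) (Pi.single i 1, 0)

theorem contDiff_hamiltonDefect {n : ℕ} {H : ((Fin n → ℝ) × (Fin n → ℝ)) → ℝ}
    (hH : ContDiff ℝ (⊤ : ℕ∞) H) {q p : ℝ → Fin n → ℝ}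
    (hq : ContDiff ℝ (⊤ : ℕ∞) q) (hp : ContDiff ℝ (⊤ : ℕ∞) p) :
    ContDiff ℝ (⊤ : ℕ∞) (hamiltonDefect H q p) := by
  have hp' : ContDiff ℝ (⊤ : ℕ∞) (deriv p) := (contDiff_infty_iff_deriv.mp hp).2
  have hH' : ContDiff ℝ (⊤ : ℕ∞) (fderiv ℝ H) := hH.fderiv_right (by simp)
  refine contDiff_pi.mpr fun i => (contDiff_pi.mp hp' i).add ?_
  exact (hH'.comp (hq.prodMk hp)).clm_apply contDiff_const

theorem fderiv_fst_eq_sum {n : ℕ} (L : ((Fin n → ℝ) × (Fin n → ℝ)) →L[ℝ] ℝ) (v : Fin n → ℝ) :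
    L (v, 0) = ∑ i, v i * L (Pi.single i 1, 0) := by
  have h := (L.comp (ContinuousLinearMap.inl ℝ _ _)).toLinearMap.pi_apply_eq_sum_univ v
  have hs (i : Fin n) : (fun j => if i = j then (1 : ℝ) else 0) = Pi.single i 1 := by
    ext j
    simp [Pi.single_apply, eq_comm]
  simpa [hs] using h

theorem hasDerivAt_comp_graph {n : ℕ} {X : (ℝ × (Fin n → ℝ)) → (Fin n → ℝ)}
    (hX : Differentiable ℝ X) {q : ℝ → Fin n → ℝ} (hq : Differentiable ℝ q) (t : ℝ) :
    HasDerivAt (fun s => X (s, q s))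
      (fderiv ℝ X (t, q t) (1, 0) + fderiv ℝ X (t, q t) (0, deriv q t)) t := by
  have h := (hX (t, q t)).hasFDerivAt.comp_hasDerivAt t
    ((hasDerivAt_id t).prodMk (hq t).hasDerivAt)
  rw [← map_add, Prod.mk_add_mk, add_zero, zero_add]
  exact h

/-- First variation formula: integrating by parts, the generalized variation in the direction of
`X` is minus the pairing of the defect of Hamilton's equation with `X` along the curve. -/
theorem integral_variation_eq_neg_integral_hamiltonDefect {n : ℕ}
    {H : ((Fin n → ℝ) × (Fin n → ℝ)) → ℝ} (hH : ContDiff ℝ (⊤ : ℕ∞) H) {t₀ t₁ : ℝ}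
    {q p : ℝ → Fin n → ℝ} (hq : ContDiff ℝ (⊤ : ℕ∞) q) (hp : ContDiff ℝ (⊤ : ℕ∞) p)
    {X : (ℝ × (Fin n → ℝ)) → (Fin n → ℝ)} (hX : ContDiff ℝ (⊤ : ℕ∞) X)
    (h₀ : X (t₀, q t₀) = 0) (h₁ : X (t₁, q t₁) = 0) :
    ∫ t in t₀..t₁,
        (-(fderiv ℝ H (q t, p t) (X (t, q t), 0)) +
          ∑ i, p t i *
            (fderiv ℝ X (t, q t) (1, 0) i + fderiv ℝ X (t, q t) (0, deriv q t) i)) =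
      -∫ t in t₀..t₁, ∑ i, hamiltonDefect H q p t i * X (t, q t) i := by
  have hY : ContDiff ℝ (⊤ : ℕ∞) fun t => X (t, q t) := hX.comp (contDiff_id.prodMk hq)
  have hg := contDiff_hamiltonDefect hH hq hp
  have hF : ContDiff ℝ (⊤ : ℕ∞) fun t => ∑ i, p t i * X (t, q t) i :=
    ContDiff.sum fun i _ => (contDiff_pi.mp hp i).mul (contDiff_pi.mp hY i)
  have hG : Continuous fun t => ∑ i, hamiltonDefect H q p t i * X (t, q t) i :=
    continuous_finsetSum _ fun i _ =>
      (contDiff_pi.mp hg i).continuous.mul (contDiff_pi.mp hY i).continuous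
  have hF' : Continuous (deriv fun t => ∑ i, p t i * X (t, q t) i) :=
    hF.continuous_deriv (by simp)
  have hzero : ∫ t in t₀..t₁, deriv (fun t => ∑ i, p t i * X (t, q t) i) t = 0 := by
    rw [intervalIntegral.integral_deriv_eq_sub
      (fun t _ => hF.differentiable (by simp) t) (hF'.intervalIntegrable _ _)]
    simp [h₀, h₁]
  have hsub : ∫ t in t₀..t₁, (deriv (fun t => ∑ i, p t i * X (t, q t) i) t -
      ∑ i, hamiltonDefect H q p t i * X (t, q t) i) =
      -∫ t in t₀..t₁, ∑ i, hamiltonDefect H q p t i * X (t, q t) i := by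
    rw [intervalIntegral.integral_sub (hF'.intervalIntegrable _ _) (hG.intervalIntegrable _ _),
      hzero, zero_sub]
  rw [← hsub]
  refine intervalIntegral.integral_congr fun t _ => ?_
  have hpt := hasDerivAt_pi.mp (hp.differentiable (by simp) t).hasDerivAt
  have hYt := hasDerivAt_pi.mp
    (hasDerivAt_comp_graph (hX.differentiable (by simp)) (hq.differentiable (by simp)) t)
  have hd := (HasDerivAt.fun_sum (u := Finset.univ) fun i _ => (hpt i).mul (hYt i)).deriv
  simp only [Pi.mul_def] at hd
  simp only [hd, fderiv_fst_eq_sum _ (X (t, q t)), hamiltonDefect, Pi.add_apply]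
  rw [← Finset.sum_neg_distrib, ← Finset.sum_add_distrib, ← Finset.sum_sub_distrib]
  exact Finset.sum_congr rfl fun i _ => by ring

/-- A continuous curve whose squared length has zero integral against the weight
`(t - t₀) * (t₁ - t)` vanishes on `[t₀, t₁]`. -/
theorem eq_zero_of_integral_weight_mul_sum_sq_eq_zero {n : ℕ} {g : ℝ → Fin n → ℝ}
    (hg : Continuous g) {t₀ t₁ : ℝ} (ht : t₀ < t₁)
    (h : ∫ t in t₀..t₁, (t - t₀) * (t₁ - t) * ∑ i, g t i ^ 2 = 0) :
    ∀ t ∈ Set.Icc t₀ t₁, g t = 0 := by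
  have hopen : Set.EqOn g 0 (Set.Ioo t₀ t₁) := by
    intro t hmem
    by_contra hne
    obtain ⟨i, hi⟩ := Function.ne_iff.mp hne
    refine (intervalIntegral.integral_pos ht (Continuous.continuousOn (by fun_prop)) ?_
      ⟨t, Set.Ioo_subset_Icc_self hmem, ?_⟩).ne' h
    · intro s hs
      exact mul_nonneg (mul_nonneg (sub_nonneg.mpr hs.1.le) (sub_nonneg.mpr hs.2))
        (Finset.sum_nonneg fun j _ => sq_nonneg _)
    · exact mul_pos (mul_pos (sub_pos.mpr hmem.1) (sub_pos.mpr hmem.2))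
        (Finset.sum_pos' (fun j _ => sq_nonneg _)
          ⟨i, Finset.mem_univ i, sq_pos_of_ne_zero hi⟩)
  have hclosed := hopen.closure hg continuous_const
  rw [closure_Ioo ht.ne] at hclosed
  exact hclosed


/-- Hamiltonian mechanics as a generalized variational problem: for curves `(q,p)` with
`q̇ = ∂H/∂p`, the generalized variational principle
`∫ ⟨(−∂H/∂q, p), X^T⟩ dt = 0` for all variations `X` vanishing at the endpoints
holds iff `ṗ = −∂H/∂q`, i.e. `(q,p)` satisfies Hamilton's equations. -/
theorem generalized_variational_iff_hamilton (n : ℕ)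
    (H : ((Fin n → ℝ) × (Fin n → ℝ)) → ℝ) (hH : ContDiff ℝ (⊤ : ℕ∞) H)
    (t₀ t₁ : ℝ) (ht : t₀ < t₁)
    (q p : ℝ → Fin n → ℝ) (hq : ContDiff ℝ (⊤ : ℕ∞) q) (hp : ContDiff ℝ (⊤ : ℕ∞) p)
    (hqdot : ∀ t ∈ Set.Icc t₀ t₁, ∀ i,
      deriv q t i = fderiv ℝ H (q t, p t) (0, Pi.single i 1)) :
    (∀ X : (ℝ × (Fin n → ℝ)) → (Fin n → ℝ), ContDiff ℝ (⊤ : ℕ∞) X →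
        X (t₀, q t₀) = 0 → X (t₁, q t₁) = 0 →
        ∫ t in t₀..t₁,
          (-(fderiv ℝ H (q t, p t) (X (t, q t), 0)) +
            ∑ i, p t i *
              (fderiv ℝ X (t, q t) (1, 0) i + fderiv ℝ X (t, q t) (0, deriv q t) i)) = 0) ↔
      (∀ t ∈ Set.Icc t₀ t₁, ∀ i,
        deriv (fun s => p s i) t = -(fderiv ℝ H (q t, p t) (Pi.single i 1, 0))) := by
  have hderiv (t : ℝ) (i : Fin n) : deriv (fun s => p s i) t = deriv p t i :=
    (hasDerivAt_pi.mp (hp.differentiable (by simp) t).hasDerivAt i).deriv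
  have hg := contDiff_hamiltonDefect hH hq hp
  constructor
  · intro h
    have hX : ContDiff ℝ (⊤ : ℕ∞) fun x : ℝ × (Fin n → ℝ) =>
        ((x.1 - t₀) * (t₁ - x.1)) • hamiltonDefect H q p x.1 :=
      ((contDiff_fst.sub contDiff_const).mul (contDiff_const.sub contDiff_fst)).smul
        (hg.comp contDiff_fst)
    have hvar := h _ hX (by simp) (by simp)
    rw [integral_variation_eq_neg_integral_hamiltonDefect hH hq hp hX (by simp) (by simp),
      neg_eq_zero] at hvar
    have hzero := eq_zero_of_integral_weight_mul_sum_sq_eq_zero hg.continuous ht <| by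
      rw [← hvar]
      refine intervalIntegral.integral_congr fun t _ => ?_
      simp only [Finset.mul_sum, Pi.smul_apply, smul_eq_mul]
      exact Finset.sum_congr rfl fun i _ => by ring
    intro t hmem i
    rw [hderiv]
    exact eq_neg_of_add_eq_zero_left (congrFun (hzero t hmem) i)
  · intro h X hX h₀ h₁
    rw [integral_variation_eq_neg_integral_hamiltonDefect hH hq hp hX h₀ h₁, neg_eq_zero]
    refine intervalIntegral.integral_zero_ae (Filter.Eventually.of_forall fun t hmem => ?_)
    rw [Set.uIoc_of_le ht.le] at hmem
    refine Finset.sum_eq_zero fun i _ => ?_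
    have hi := h t (Set.Ioc_subset_Icc_self hmem) i
    rw [hderiv] at hi
    simp [hamiltonDefect, hi]
end

section
/- Let L : ℝⁿ × ℝⁿ → ℝ and φ = (φ¹,…,φᵐ) : ℝⁿ × ℝⁿ → ℝᵐ be smooth, let t₀ < t₁, let σ : [t₀,t₁] → ℝⁿ be smooth with φ^α(σ(t),σ'(t)) = 0 for all t and all α, and let λ = (λ₁,…,λ_m) : [t₀,t₁] → ℝᵐ be smooth. Then the following are equivalent: (a) for every smooth time-dependent vector field X : ℝ × ℝⁿ → ℝⁿ with X(t₀,σ(t₀)) = 0 and X(t₁,σ(t₁)) = 0, ∫_{t₀}^{t₁} ⟨ dL(σ(t),σ'(t)) + Σ_α λ_α(t) dφ^α(σ(t),σ'(t)) , X^T(t,σ(t),σ'(t)) ⟩ dt = 0; (b) for all t, d/dt[ D₂L(σ(t),σ'(t)) + Σ_α λ_α(t) D₂φ^α(σ(t),σ'(t)) ] = D₁L(σ(t),σ'(t)) + Σ_α λ_α(t) D₁φ^α(σ(t),σ'(t)) as linear functionals on ℝⁿ (the vakonomic, i.e. constrained variational, equations of motion). -/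
open Set intervalIntegral in
/-- Integration by parts for a time-dependent covector `P` paired with the velocity lift of a
curve `ξ` that vanishes at both endpoints. -/
lemma integral_pairing_velocity_eq {E : Type*} [NormedAddCommGroup E] [NormedSpace ℝ E]
    {P : ℝ → (E × E) →L[ℝ] ℝ} (hP : ContDiff ℝ 1 P) {ξ : ℝ → E} (hξ : ContDiff ℝ 1 ξ)
    {a b : ℝ} (ha : ξ a = 0) (hb : ξ b = 0) :
    ∫ t in a..b, P t (ξ t, deriv ξ t) =
      ∫ t in a..b, (P t (ξ t, 0) - deriv P t (0, ξ t)) := by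
  have hP' : Continuous (deriv P) := hP.continuous_deriv le_rfl
  have hξ' : Continuous (deriv ξ) := hξ.continuous_deriv le_rfl
  have hPc : Continuous P := hP.continuous
  have hξc : Continuous ξ := hξ.continuous
  have hderiv : ∀ t, HasDerivAt (fun s => P s (0, ξ s))
      (deriv P t (0, ξ t) + P t (0, deriv ξ t)) t := fun t =>
    ((hP.differentiable one_ne_zero t).hasDerivAt).clm_apply
      ((hasDerivAt_const t (0 : E)).prodMk (hξ.differentiable one_ne_zero t).hasDerivAt)
  have hzero : ∫ t in a..b, (deriv P t (0, ξ t) + P t (0, deriv ξ t)) = 0 := by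
    rw [integral_eq_sub_of_hasDerivAt (fun t _ => hderiv t)
      (Continuous.intervalIntegrable (by fun_prop) _ _)]
    simp [ha, hb, ← Prod.zero_eq_mk]
  rw [← sub_eq_zero, ← integral_sub (Continuous.intervalIntegrable (by fun_prop) _ _)
    (Continuous.intervalIntegrable (by fun_prop) _ _), ← hzero]
  refine integral_congr fun t _ => ?_
  have hsplit : P t (ξ t, deriv ξ t) = P t (ξ t, 0) + P t (0, deriv ξ t) := by
    rw [← map_add]; simp
  simp only [hsplit]
  ring

open Set in
/-- The fundamental lemma of the calculus of variations, for the weight `(t - a) * (b - t)`. -/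
lemma eq_zero_of_integral_weight_mul_sq_eq_zero {f : ℝ → ℝ} (hf : Continuous f) {a b : ℝ}
    (hab : a < b) (h : ∫ t in a..b, (t - a) * (b - t) * f t ^ 2 = 0) :
    ∀ t ∈ Icc a b, f t = 0 := by
  have hIoo : EqOn f (fun _ => 0) (Ioo a b) := by
    intro c hc
    by_contra hne
    refine (intervalIntegral.integral_pos hab (Continuous.continuousOn (by fun_prop))
      (fun x hx => ?_) ⟨c, Ioo_subset_Icc_self hc, ?_⟩).ne' h
    · exact mul_nonneg (mul_nonneg (sub_nonneg.2 hx.1.le) (sub_nonneg.2 hx.2)) (sq_nonneg _)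
    · exact mul_pos (mul_pos (sub_pos.2 hc.1) (sub_pos.2 hc.2)) (sq_pos_of_ne_zero hne)
  rw [← closure_Ioo hab.ne]
  exact hIoo.closure hf continuous_const

/-- The derivative of a time-dependent vector field along the graph of a curve. -/
lemma deriv_comp_graph {E F : Type*} [NormedAddCommGroup E] [NormedSpace ℝ E]
    [NormedAddCommGroup F] [NormedSpace ℝ F] {X : ℝ × E → F} (hX : Differentiable ℝ X)
    {σ : ℝ → E} (hσ : Differentiable ℝ σ) (t : ℝ) :
    deriv (fun s => X (s, σ s)) t =
      fderiv ℝ X (t, σ t) (1, 0) + fderiv ℝ X (t, σ t) (0, deriv σ t) := by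
  have h := (hX (t, σ t)).hasFDerivAt.comp_hasDerivAt t
    ((hasDerivAt_id t).prodMk (hσ t).hasDerivAt)
  rw [← map_add, Prod.mk_add_mk, add_zero, zero_add]
  exact h.deriv

/-- The variational principle for a smooth time-dependent covector `P` along `σ` is equivalent to
the Euler–Lagrange equations for `P`. -/
lemma variational_iff_eulerLagrange {E : Type*} [NormedAddCommGroup E] [NormedSpace ℝ E]
    {P : ℝ → (E × E) →L[ℝ] ℝ} (hP : ContDiff ℝ (⊤ : ℕ∞) P) {σ : ℝ → E}
    (hσ : ContDiff ℝ (⊤ : ℕ∞) σ) {a b : ℝ} (hab : a < b) :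
    (∀ X : ℝ × E → E, ContDiff ℝ (⊤ : ℕ∞) X → X (a, σ a) = 0 → X (b, σ b) = 0 →
        ∫ t in a..b, P t (X (t, σ t),
          fderiv ℝ X (t, σ t) (1, 0) + fderiv ℝ X (t, σ t) (0, deriv σ t)) = 0) ↔
      ∀ t ∈ Set.Icc a b, ∀ w : E, deriv (fun s => P s (0, w)) t = P t (w, 0) := by
  have hP' : ContDiff ℝ (⊤ : ℕ∞) (deriv P) := (contDiff_infty_iff_deriv.1 hP).2
  have hderiv : ∀ t w, deriv (fun s => P s (0, w)) t = deriv P t (0, w) := fun t w => by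
    simpa using ((hP.differentiable (by simp) t).hasDerivAt.clm_apply
      (hasDerivAt_const t ((0 : E), w))).deriv
  have hparts : ∀ X : ℝ × E → E, ContDiff ℝ (⊤ : ℕ∞) X → X (a, σ a) = 0 → X (b, σ b) = 0 →
      ∫ t in a..b, P t (X (t, σ t),
          fderiv ℝ X (t, σ t) (1, 0) + fderiv ℝ X (t, σ t) (0, deriv σ t)) =
        ∫ t in a..b, (P t (X (t, σ t), 0) - deriv P t (0, X (t, σ t))) := by
    intro X hX ha hb
    have hξ : ContDiff ℝ (⊤ : ℕ∞) (fun t => X (t, σ t)) := hX.comp (contDiff_id.prodMk hσ)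
    rw [← integral_pairing_velocity_eq (hP.of_le (by exact_mod_cast le_top))
      (hξ.of_le (by exact_mod_cast le_top)) ha hb]
    simp only [deriv_comp_graph (hX.differentiable (by simp)) (hσ.differentiable (by simp))]
  simp only [hderiv]
  constructor
  · intro h t ht w
    have hR : ContDiff ℝ (⊤ : ℕ∞) (fun s => P s (w, 0) - deriv P s (0, w)) :=
      (hP.clm_apply contDiff_const).sub (hP'.clm_apply contDiff_const)
    set R : ℝ → ℝ := fun s => P s (w, 0) - deriv P s (0, w) with hRdef
    have hX : ContDiff ℝ (⊤ : ℕ∞)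
        (fun z : ℝ × E => ((z.1 - a) * (b - z.1) * R z.1) • w) :=
      (((contDiff_fst.sub contDiff_const).mul (contDiff_const.sub contDiff_fst)).mul
        (hR.comp contDiff_fst)).smul contDiff_const
    have hint := h _ hX (by simp) (by simp)
    rw [hparts _ hX (by simp) (by simp)] at hint
    have hR0 := eq_zero_of_integral_weight_mul_sq_eq_zero hR.continuous hab
      (hint ▸ intervalIntegral.integral_congr fun s _ => ?_) t ht
    · exact (sub_eq_zero.1 hR0).symm
    · have h₁ : ∀ c : ℝ, (c • w, (0 : E)) = c • (w, (0 : E)) := fun c => by simp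
      have h₂ : ∀ c : ℝ, ((0 : E), c • w) = c • ((0 : E), w) := fun c => by simp
      simp only [h₁, h₂, map_smul, smul_eq_mul, hRdef]
      ring
  · intro h X hX ha hb
    rw [hparts X hX ha hb]
    refine (intervalIntegral.integral_congr (g := fun _ => (0 : ℝ)) fun t ht => ?_).trans (by simp)
    rw [Set.uIcc_of_le hab.le] at ht
    simp [h t ht]


/-- Constrained variational (vakonomic) mechanics: for a curve `σ` satisfying the
constraints `φ^α(σ, σ') = 0` and multipliers `λ_α`, the generalized variational
principle `∫ ⟨dL + λ_α dφ^α, X^T⟩ dt = 0` for all variations vanishing at the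
endpoints holds iff the vakonomic equations
`d/dt(D₂L + λ_α D₂φ^α) = D₁L + λ_α D₁φ^α` hold. -/
theorem generalized_variational_iff_vakonomic (n m : ℕ)
    (L : ((Fin n → ℝ) × (Fin n → ℝ)) → ℝ) (hL : ContDiff ℝ (⊤ : ℕ∞) L)
    (φ : ((Fin n → ℝ) × (Fin n → ℝ)) → Fin m → ℝ) (hφ : ContDiff ℝ (⊤ : ℕ∞) φ)
    (t₀ t₁ : ℝ) (ht : t₀ < t₁)
    (σ : ℝ → Fin n → ℝ) (hσ : ContDiff ℝ (⊤ : ℕ∞) σ)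
    (hcon : ∀ t ∈ Set.Icc t₀ t₁, ∀ α, φ (σ t, deriv σ t) α = 0)
    (lam : ℝ → Fin m → ℝ) (hlam : ContDiff ℝ (⊤ : ℕ∞) lam) :
    (∀ X : (ℝ × (Fin n → ℝ)) → (Fin n → ℝ), ContDiff ℝ (⊤ : ℕ∞) X →
        X (t₀, σ t₀) = 0 → X (t₁, σ t₁) = 0 →
        ∫ t in t₀..t₁,
          (fderiv ℝ L (σ t, deriv σ t)
              (X (t, σ t),
                fderiv ℝ X (t, σ t) (1, 0) + fderiv ℝ X (t, σ t) (0, deriv σ t)) +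
            ∑ α, lam t α *
              fderiv ℝ (fun z : (Fin n → ℝ) × (Fin n → ℝ) => φ z α) (σ t, deriv σ t)
                (X (t, σ t),
                  fderiv ℝ X (t, σ t) (1, 0) + fderiv ℝ X (t, σ t) (0, deriv σ t))) = 0) ↔
      (∀ t ∈ Set.Icc t₀ t₁, ∀ w : Fin n → ℝ,
        deriv (fun s =>
            fderiv ℝ L (σ s, deriv σ s) (0, w) +
              ∑ α, lam s α *
                fderiv ℝ (fun z : (Fin n → ℝ) × (Fin n → ℝ) => φ z α) (σ s, deriv σ s)
                  (0, w)) t =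
          fderiv ℝ L (σ t, deriv σ t) (w, 0) +
            ∑ α, lam t α *
              fderiv ℝ (fun z : (Fin n → ℝ) × (Fin n → ℝ) => φ z α) (σ t, deriv σ t)
                (w, 0)) := by
  have hjet : ContDiff ℝ (⊤ : ℕ∞) (fun t => (σ t, deriv σ t)) :=
    hσ.prodMk (contDiff_infty_iff_deriv.1 hσ).2
  have hP : ContDiff ℝ (⊤ : ℕ∞) (fun t => fderiv ℝ L (σ t, deriv σ t) +
      ∑ α, lam t α •
        fderiv ℝ (fun z : (Fin n → ℝ) × (Fin n → ℝ) => φ z α) (σ t, deriv σ t)) :=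
    ((hL.fderiv_right (m := (⊤ : ℕ∞)) (by simp)).comp hjet).add <| ContDiff.sum fun α _ =>
      (contDiff_pi.1 hlam α).smul
        (((contDiff_pi.1 hφ α).fderiv_right (m := (⊤ : ℕ∞)) (by simp)).comp hjet)
  simpa only [add_apply, sum_apply,
    smul_apply, smul_eq_mul] using variational_iff_eulerLagrange hP hσ ht
end

section
/- Let n = r + m, write points of ℝⁿ as q and velocities as v = (v^a, v^α) ∈ ℝ^r × ℝᵐ. Let Φ : ℝⁿ × ℝ^r → ℝᵐ and l : ℝⁿ × ℝ^r → ℝ be smooth, let t₀ < t₁, let σ : [t₀,t₁] → ℝⁿ be a smooth curve whose velocity satisfies the solved constraints σ'(t) = (w(t), Φ(σ(t), w(t))) where w(t) ∈ ℝ^r is the first block of σ'(t), and let μ̃ : [t₀,t₁] → (ℝᵐ)* be smooth. Define the covector μ(t) at (σ(t),σ'(t)) ∈ ℝⁿ × ℝⁿ by μ(t) = ( D_q l(σ(t),w(t)) − μ̃(t)∘D_qΦ(σ(t),w(t)) , ( D_w l(σ(t),w(t)) − μ̃(t)∘D_wΦ(σ(t),w(t)) , μ̃(t) ) ), where the second slot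 is a covector on ℝ^r × ℝᵐ. Then the following are equivalent: (a) for every smooth time-dependent vector field X : ℝ × ℝⁿ → ℝⁿ with X(t₀,σ(t₀)) = 0 and X(t₁,σ(t₁)) = 0, ∫_{t₀}^{t₁} ⟨ μ(t), X^T(t,σ(t),σ'(t)) ⟩ dt = 0; (b) the curve p : [t₀,t₁] → (ℝⁿ)* defined by p(t) = ( D_w l(σ(t),w(t)) − μ̃(t)∘D_wΦ(σ(t),w(t)) , μ̃(t) ) satisfies p'(t) = D_q l(σ(t),w(t)) − μ̃(t)∘D_qΦ(σ(t),w(t)) for all t. -/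
/-- A smooth function whose integral against every smooth function vanishing at the endpoints of a
nondegenerate interval is zero vanishes on that interval. -/
theorem eqOn_zero_of_integral_smooth_mul_eq_zero {a b : ℝ} (hab : a < b) {g : ℝ → ℝ}
    (hg : ContDiff ℝ (⊤ : ℕ∞) g)
    (h : ∀ f : ℝ → ℝ, ContDiff ℝ (⊤ : ℕ∞) f → f a = 0 → f b = 0 → ∫ t in a..b, f t * g t = 0) :
    Set.EqOn g 0 (Set.Icc a b) := by
  have hf : ContDiff ℝ (⊤ : ℕ∞) fun t => (t - a) * (b - t) * g t := by fun_prop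
  have hint := h _ hf (by simp) (by simp)
  have hIoo : Set.EqOn g 0 (Set.Ioo a b) := by
    intro c hc
    by_contra hgc
    have hfg : Continuous fun t => (t - a) * (b - t) * g t * g t := hf.continuous.mul hg.continuous
    refine (intervalIntegral.integral_pos hab hfg.continuousOn
      (fun t htab => ?_) ⟨c, Set.Ioo_subset_Icc_self hc, ?_⟩).ne' hint
    · rw [mul_assoc]
      exact mul_nonneg (mul_nonneg (sub_nonneg.2 htab.1.le) (sub_nonneg.2 htab.2))
        (mul_self_nonneg _)
    · rw [mul_assoc]
      exact mul_pos (mul_pos (sub_pos.2 hc.1) (sub_pos.2 hc.2)) (mul_self_pos.2 hgc)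
  exact hIoo.of_subset_closure hg.continuous.continuousOn continuousOn_const
    Set.Ioo_subset_Icc_self (closure_Ioo hab.ne).ge

/-- Along a smooth curve `σ`, the covector `(A, p)` annihilates in the mean the tangent lifts of all
smooth time-dependent vector fields vanishing at the endpoints of `σ` iff `ṗ = A`. -/
theorem integral_tangentLift_eq_zero_iff_deriv_eq {E : Type*} [NormedAddCommGroup E]
    [NormedSpace ℝ E] {a b : ℝ} (hab : a < b) {σ : ℝ → E} (hσ : ContDiff ℝ (⊤ : ℕ∞) σ)
    {p A : ℝ → E →L[ℝ] ℝ} (hp : ContDiff ℝ (⊤ : ℕ∞) p) (hA : ContDiff ℝ (⊤ : ℕ∞) A) :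
    (∀ X : ℝ × E → E, ContDiff ℝ (⊤ : ℕ∞) X → X (a, σ a) = 0 → X (b, σ b) = 0 →
      ∫ t in a..b, (A t (X (t, σ t)) +
        p t (fderiv ℝ X (t, σ t) (1, 0) + fderiv ℝ X (t, σ t) (0, deriv σ t))) = 0) ↔
      ∀ t ∈ Set.Icc a b, deriv p t = A t := by
  have hp' : ContDiff ℝ (⊤ : ℕ∞) (deriv p) := (contDiff_infty_iff_deriv.1 hp).2
  have hσ' : ContDiff ℝ (⊤ : ℕ∞) (deriv σ) := (contDiff_infty_iff_deriv.1 hσ).2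
  have key : ∀ X : ℝ × E → E, ContDiff ℝ (⊤ : ℕ∞) X → X (a, σ a) = 0 → X (b, σ b) = 0 →
      ∫ t in a..b, (A t (X (t, σ t)) +
        p t (fderiv ℝ X (t, σ t) (1, 0) + fderiv ℝ X (t, σ t) (0, deriv σ t))) =
      ∫ t in a..b, (A t - deriv p t) (X (t, σ t)) := by
    intro X hX ha hb
    have hY : ∀ t, HasDerivAt (fun s => X (s, σ s))
        (fderiv ℝ X (t, σ t) (1, 0) + fderiv ℝ X (t, σ t) (0, deriv σ t)) t := by
      intro t
      have hXt : HasFDerivAt X (fderiv ℝ X (t, σ t)) (t, σ t) :=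
        (hX.differentiable (by simp) _).hasFDerivAt
      have hσt : HasDerivAt σ (deriv σ t) t := (hσ.differentiable (by simp) _).hasDerivAt
      have := hXt.comp_hasDerivAt t ((hasDerivAt_id t).prodMk hσt)
      rw [← map_add]
      simpa [Function.comp_def] using this
    have hpY : ∀ t, HasDerivAt (fun s => p s (X (s, σ s))) (deriv p t (X (t, σ t)) +
        p t (fderiv ℝ X (t, σ t) (1, 0) + fderiv ℝ X (t, σ t) (0, deriv σ t))) t := fun t =>
      (hp.differentiable (by simp) t).hasDerivAt.clm_apply (hY t)
    have hγ : ContDiff ℝ (⊤ : ℕ∞) fun t => (t, σ t) := contDiff_id.prodMk hσ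
    have hXγ : Continuous fun t => X (t, σ t) := (hX.comp hγ).continuous
    have hDX : Continuous fun t => fderiv ℝ X (t, σ t) :=
      (hX.continuous_fderiv (by simp)).comp hγ.continuous
    have hpc : Continuous p := hp.continuous
    have hpc' : Continuous (deriv p) := hp'.continuous
    have hAc : Continuous A := hA.continuous
    have hσc' : Continuous (deriv σ) := hσ'.continuous
    have hcont : Continuous fun t => deriv p t (X (t, σ t)) +
        p t (fderiv ℝ X (t, σ t) (1, 0) + fderiv ℝ X (t, σ t) (0, deriv σ t)) := by fun_prop
    have hftc := intervalIntegral.integral_eq_sub_of_hasDerivAt (fun t _ => hpY t)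
      (hcont.intervalIntegrable a b)
    rw [ha, hb, map_zero, map_zero, sub_zero] at hftc
    have hcont₂ : Continuous fun t => (A t - deriv p t) (X (t, σ t)) := by fun_prop
    have hadd := intervalIntegral.integral_add (hcont₂.intervalIntegrable a b)
      (hcont.intervalIntegrable a b) (μ := MeasureTheory.volume)
    rw [hftc, add_zero] at hadd
    rw [← hadd]
    congr 1 with t
    rw [sub_apply]
    ring
  constructor
  · intro h t ht
    ext v
    have hg : ContDiff ℝ (⊤ : ℕ∞) fun s => (A s - deriv p s) v :=
      (hA.sub hp').clm_apply contDiff_const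
    have hzero := eqOn_zero_of_integral_smooth_mul_eq_zero hab hg (fun f hf hfa hfb => by
      have hX : ContDiff ℝ (⊤ : ℕ∞) fun x : ℝ × E => f x.1 • v :=
        (hf.comp contDiff_fst).smul contDiff_const
      have hXa : (fun x : ℝ × E => f x.1 • v) (a, σ a) = 0 := by simp [hfa]
      have hXb : (fun x : ℝ × E => f x.1 • v) (b, σ b) = 0 := by simp [hfb]
      have hint := (key _ hX hXa hXb).symm.trans (h _ hX hXa hXb)
      simpa only [map_smul, smul_eq_mul] using hint) ht
    exact (sub_eq_zero.1 hzero).symm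
  · intro h X hX ha hb
    rw [key X hX ha hb]
    refine intervalIntegral.integral_zero_ae (Filter.Eventually.of_forall fun t ht => ?_)
    rw [Set.uIoc_of_le hab.le] at ht
    rw [h t (Set.Ioc_subset_Icc_self ht), sub_self, zero_apply]

/-- Constrained variational calculus with solved constraints `v^α = Φ^α(q, v^a)`:
the generalized variational principle for the covector
`μ = (D_q l − μ̃∘D_qΦ, (D_w l − μ̃∘D_wΦ, μ̃))` along a curve satisfying the constraints
holds for all variations vanishing at the endpoints iff the momentum
`p = (D_w l − μ̃∘D_wΦ, μ̃)` satisfies `ṗ = D_q l − μ̃∘D_qΦ`. -/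
theorem generalized_variational_iff_solved_vakonomic (r m : ℕ)
    (Φ : (((Fin r → ℝ) × (Fin m → ℝ)) × (Fin r → ℝ)) → (Fin m → ℝ))
    (hΦ : ContDiff ℝ (⊤ : ℕ∞) Φ)
    (l : (((Fin r → ℝ) × (Fin m → ℝ)) × (Fin r → ℝ)) → ℝ) (hl : ContDiff ℝ (⊤ : ℕ∞) l)
    (t₀ t₁ : ℝ) (ht : t₀ < t₁)
    (σ : ℝ → (Fin r → ℝ) × (Fin m → ℝ)) (hσ : ContDiff ℝ (⊤ : ℕ∞) σ)
    (hadm : ∀ t ∈ Set.Icc t₀ t₁, (deriv σ t).2 = Φ (σ t, (deriv σ t).1))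
    (μt : ℝ → ((Fin m → ℝ) →L[ℝ] ℝ)) (hμt : ContDiff ℝ (⊤ : ℕ∞) μt) :
    (∀ X : (ℝ × ((Fin r → ℝ) × (Fin m → ℝ))) → ((Fin r → ℝ) × (Fin m → ℝ)),
        ContDiff ℝ (⊤ : ℕ∞) X → X (t₀, σ t₀) = 0 → X (t₁, σ t₁) = 0 →
        ∫ t in t₀..t₁,
          ((fderiv ℝ l (σ t, (deriv σ t).1) (X (t, σ t), 0) -
              μt t (fderiv ℝ Φ (σ t, (deriv σ t).1) (X (t, σ t), 0))) +
            ((fderiv ℝ l (σ t, (deriv σ t).1)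
                (0, (fderiv ℝ X (t, σ t) (1, 0) + fderiv ℝ X (t, σ t) (0, deriv σ t)).1) -
              μt t (fderiv ℝ Φ (σ t, (deriv σ t).1)
                (0, (fderiv ℝ X (t, σ t) (1, 0) + fderiv ℝ X (t, σ t) (0, deriv σ t)).1))) +
              μt t ((fderiv ℝ X (t, σ t) (1, 0) +
                fderiv ℝ X (t, σ t) (0, deriv σ t)).2))) = 0) ↔
      (∀ t ∈ Set.Icc t₀ t₁, ∀ v : (Fin r → ℝ) × (Fin m → ℝ),
        deriv (fun s =>
            (fderiv ℝ l (σ s, (deriv σ s).1) (0, v.1) -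
              μt s (fderiv ℝ Φ (σ s, (deriv σ s).1) (0, v.1))) + μt s v.2) t =
          fderiv ℝ l (σ t, (deriv σ t).1) (v, 0) -
            μt t (fderiv ℝ Φ (σ t, (deriv σ t).1) (v, 0))) := by
  have hσ' : ContDiff ℝ (⊤ : ℕ∞) (deriv σ) := (contDiff_infty_iff_deriv.1 hσ).2
  have hγ : ContDiff ℝ (⊤ : ℕ∞) fun t => (σ t, (deriv σ t).1) := hσ.prodMk hσ'.fst
  let F : ℝ → (((Fin r → ℝ) × (Fin m → ℝ)) × (Fin r → ℝ)) →L[ℝ] ℝ := fun t =>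
    fderiv ℝ l (σ t, (deriv σ t).1) - (μt t).comp (fderiv ℝ Φ (σ t, (deriv σ t).1))
  have hF : ContDiff ℝ (⊤ : ℕ∞) F :=
    ((hl.fderiv_right (m := (⊤ : ℕ∞)) (by simp)).comp hγ).sub
      (hμt.clm_comp ((hΦ.fderiv_right (m := (⊤ : ℕ∞)) (by simp)).comp hγ))
  let p : ℝ → ((Fin r → ℝ) × (Fin m → ℝ)) →L[ℝ] ℝ := fun t =>
    (F t).comp ((ContinuousLinearMap.inr ℝ ((Fin r → ℝ) × (Fin m → ℝ)) (Fin r → ℝ)).comp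
      (ContinuousLinearMap.fst ℝ (Fin r → ℝ) (Fin m → ℝ))) +
    (μt t).comp (ContinuousLinearMap.snd ℝ (Fin r → ℝ) (Fin m → ℝ))
  have hp : ContDiff ℝ (⊤ : ℕ∞) p :=
    (hF.clm_comp contDiff_const).add (hμt.clm_comp contDiff_const)
  let A : ℝ → ((Fin r → ℝ) × (Fin m → ℝ)) →L[ℝ] ℝ := fun t =>
    (F t).comp (ContinuousLinearMap.inl ℝ ((Fin r → ℝ) × (Fin m → ℝ)) (Fin r → ℝ))
  have hA : ContDiff ℝ (⊤ : ℕ∞) A := hF.clm_comp contDiff_const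
  have hderiv : ∀ t v, deriv (fun s => p s v) t = deriv p t v := fun t v => by
    simpa using ((hp.differentiable (by simp) t).hasDerivAt.clm_apply
      (hasDerivAt_const t v)).deriv
  refine (integral_tangentLift_eq_zero_iff_deriv_eq ht hσ hp hA).trans
    (forall₂_congr fun t _ => ?_)
  rw [ContinuousLinearMap.ext_iff]
  refine forall_congr' fun v => ?_
  rw [← hderiv t v]
  rfl
end

section
/- Let Γ : ℝⁿ × ℝˢ → ℝⁿ (controlled dynamics) and L : ℝⁿ × ℝˢ → ℝ (cost function) be smooth, let t₀ < t₁, and let q : [t₀,t₁] → ℝⁿ, u : [t₀,t₁] → ℝˢ, μ̃ : [t₀,t₁] → (ℝⁿ)* be smooth curves satisfying for all t: q'(t) = Γ(q(t),u(t)) and μ̃(t)∘D_uΓ(q(t),u(t)) = D_uL(q(t),u(t)). Define the covector μ(t) at (q(t),q'(t)) by μ(t) = ( D_qL(q(t),u(t)) − μ̃(t)∘D_qΓ(q(t),u(t)) , μ̃(t) ). Then the following are equivalent: (a) for every smooth time-dependent vector field X : ℝ × ℝⁿ → ℝⁿ with X(t₀,q(t₀)) = 0 and X(t₁,q(t₁))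 = 0, ∫_{t₀}^{t₁} ⟨ μ(t), X^T(t,q(t),q'(t)) ⟩ dt = 0; (b) μ̃'(t) = D_qL(q(t),u(t)) − μ̃(t)∘D_qΓ(q(t),u(t)) for all t, i.e. the Hamilton–Pontryagin costate equation μ̃' = −∂H/∂q holds for Pontryagin's Hamiltonian H(q,μ̃,u) = μ̃(Γ(q,u)) − L(q,u). -/
open Set intervalIntegral in
/-- Integration by parts for the pairing of a curve of covectors with a curve of vectors that
vanishes at both endpoints. -/
theorem integral_pairing_add_eq_of_endpoints_eq_zero {E : Type*} [NormedAddCommGroup E]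
    [NormedSpace ℝ E] {A p : ℝ → E →L[ℝ] ℝ} {Y : ℝ → E} {a b : ℝ} (hA : Continuous A)
    (hp : ContDiff ℝ 1 p) (hY : ContDiff ℝ 1 Y) (ha : Y a = 0) (hb : Y b = 0) :
    ∫ t in a..b, (A t (Y t) + p t (deriv Y t)) = ∫ t in a..b, (A t - deriv p t) (Y t) := by
  have hp' : Continuous (deriv p) := hp.continuous_deriv le_rfl
  have hY' : Continuous (deriv Y) := hY.continuous_deriv le_rfl
  have hder (t : ℝ) :
      HasDerivAt (fun t => p t (Y t)) (deriv p t (Y t) + p t (deriv Y t)) t :=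
    ((hp.differentiable one_ne_zero) t).hasDerivAt.clm_apply
      ((hY.differentiable one_ne_zero) t).hasDerivAt
  have hcont : Continuous fun t => deriv p t (Y t) + p t (deriv Y t) :=
    (hp'.clm_apply hY.continuous).add (hp.continuous.clm_apply hY')
  have hzero : ∫ t in a..b, (deriv p t (Y t) + p t (deriv Y t)) = 0 := by
    rw [integral_eq_sub_of_hasDerivAt (fun t _ => hder t) (hcont.intervalIntegrable a b)]
    simp [ha, hb]
  have hleft : Continuous fun t => A t (Y t) + p t (deriv Y t) :=
    (hA.clm_apply hY.continuous).add (hp.continuous.clm_apply hY')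
  rw [← sub_zero (∫ t in a..b, (A t (Y t) + p t (deriv Y t))), ← hzero,
    ← integral_sub (hleft.intervalIntegrable a b) (hcont.intervalIntegrable a b)]
  refine integral_congr fun t _ => ?_
  simp only [sub_apply]
  ring

open Set intervalIntegral in
/-- A continuous function on a nontrivial compact interval vanishes if the integral of its square
against the weight `(t - a) * (b - t)` is zero. -/
theorem eqOn_zero_of_integral_weight_mul_sq_eq_zero {f : ℝ → ℝ} {a b : ℝ} (hab : a < b)
    (hf : Continuous f) (h : ∫ t in a..b, (t - a) * (b - t) * f t ^ 2 = 0) :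
    EqOn f 0 (Icc a b) := by
  have hIoo : EqOn f 0 (Ioo a b) := by
    intro c hc
    by_contra hfc
    refine (integral_pos hab (f := fun t => (t - a) * (b - t) * f t ^ 2)
      (by fun_prop) (fun t ht => ?_) ⟨c, Ioo_subset_Icc_self hc, ?_⟩).ne' h
    · exact mul_nonneg (mul_nonneg (sub_nonneg.2 ht.1.le) (sub_nonneg.2 ht.2)) (sq_nonneg _)
    · exact mul_pos (mul_pos (sub_pos.2 hc.1) (sub_pos.2 hc.2)) (sq_pos_of_ne_zero hfc)
  simpa only [closure_Ioo hab.ne] using hIoo.closure hf continuous_const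

/-- Optimal control via generalized variational calculus: along an admissible triple
`(q, u, μ̃)` with `q̇ = Γ(q,u)` and the optimality condition
`μ̃∘D_uΓ = D_uL`, the variational principle for the covector
`μ = (D_qL − μ̃∘D_qΓ, μ̃)` holds for all variations vanishing at the endpoints iff the
Hamilton–Pontryagin costate equation `μ̃' = D_qL − μ̃∘D_qΓ` (i.e. `μ̃' = −∂H/∂q` for
`H(q,μ̃,u) = μ̃(Γ(q,u)) − L(q,u)`) holds. -/
theorem generalized_variational_iff_pontryagin_costate (n s : ℕ)
    (Γ : ((Fin n → ℝ) × (Fin s → ℝ)) → (Fin n → ℝ)) (hΓ : ContDiff ℝ (⊤ : ℕ∞) Γ)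
    (L : ((Fin n → ℝ) × (Fin s → ℝ)) → ℝ) (hL : ContDiff ℝ (⊤ : ℕ∞) L)
    (t₀ t₁ : ℝ) (ht : t₀ < t₁)
    (q : ℝ → Fin n → ℝ) (hq : ContDiff ℝ (⊤ : ℕ∞) q)
    (u : ℝ → Fin s → ℝ) (hu : ContDiff ℝ (⊤ : ℕ∞) u)
    (μt : ℝ → ((Fin n → ℝ) →L[ℝ] ℝ)) (hμt : ContDiff ℝ (⊤ : ℕ∞) μt)
    (hdyn : ∀ t ∈ Set.Icc t₀ t₁, deriv q t = Γ (q t, u t))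
    (hopt : ∀ t ∈ Set.Icc t₀ t₁, ∀ z : Fin s → ℝ,
      μt t (fderiv ℝ Γ (q t, u t) (0, z)) = fderiv ℝ L (q t, u t) (0, z)) :
    (∀ X : (ℝ × (Fin n → ℝ)) → (Fin n → ℝ), ContDiff ℝ (⊤ : ℕ∞) X →
        X (t₀, q t₀) = 0 → X (t₁, q t₁) = 0 →
        ∫ t in t₀..t₁,
          ((fderiv ℝ L (q t, u t) (X (t, q t), 0) -
              μt t (fderiv ℝ Γ (q t, u t) (X (t, q t), 0))) +
            μt t (fderiv ℝ X (t, q t) (1, 0) + fderiv ℝ X (t, q t) (0, deriv q t))) = 0) ↔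
      (∀ t ∈ Set.Icc t₀ t₁, ∀ v : Fin n → ℝ,
        deriv (fun σ => μt σ v) t =
          fderiv ℝ L (q t, u t) (v, 0) - μt t (fderiv ℝ Γ (q t, u t) (v, 0))) := by
  let A : ℝ → (Fin n → ℝ) →L[ℝ] ℝ := fun t =>
    (fderiv ℝ L (q t, u t) - (μt t).comp (fderiv ℝ Γ (q t, u t))).comp
      (ContinuousLinearMap.inl ℝ (Fin n → ℝ) (Fin s → ℝ))
  have hA : ContDiff ℝ (⊤ : ℕ∞) A := by
    have hqu := hq.prodMk hu
    have hL' := (hL.fderiv_right (m := (⊤ : ℕ∞)) (by simp)).comp hqu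
    have hΓ' := (hΓ.fderiv_right (m := (⊤ : ℕ∞)) (by simp)).comp hqu
    exact (hL'.sub (hμt.clm_comp hΓ')).clm_comp contDiff_const
  have hμ' : ContDiff ℝ (⊤ : ℕ∞) (deriv μt) := (contDiff_infty_iff_deriv.1 hμt).2
  have hderiv (t : ℝ) (v : Fin n → ℝ) : deriv (fun σ => μt σ v) t = deriv μt t v := by
    simpa using (((hμt.differentiable (by simp)) t).hasDerivAt.clm_apply
      (hasDerivAt_const t v)).deriv
  have hint (X : ℝ × (Fin n → ℝ) → (Fin n → ℝ)) (hX : ContDiff ℝ (⊤ : ℕ∞) X)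
      (h₀ : X (t₀, q t₀) = 0) (h₁ : X (t₁, q t₁) = 0) :
      ∫ t in t₀..t₁,
          ((fderiv ℝ L (q t, u t) (X (t, q t), 0) -
              μt t (fderiv ℝ Γ (q t, u t) (X (t, q t), 0))) +
            μt t (fderiv ℝ X (t, q t) (1, 0) + fderiv ℝ X (t, q t) (0, deriv q t))) =
        ∫ t in t₀..t₁, (A t - deriv μt t) (X (t, q t)) := by
    have hY : ContDiff ℝ (⊤ : ℕ∞) fun t => X (t, q t) := hX.comp (contDiff_id.prodMk hq)
    have hY' (t : ℝ) : deriv (fun t => X (t, q t)) t =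
        fderiv ℝ X (t, q t) (1, 0) + fderiv ℝ X (t, q t) (0, deriv q t) := by
      rw [← map_add, Prod.mk_add_mk, add_zero, zero_add]
      exact (((hX.differentiable (by simp)) (t, q t)).hasFDerivAt.comp_hasDerivAt t
        ((hasDerivAt_id t).prodMk ((hq.differentiable (by simp)) t).hasDerivAt)).deriv
    rw [← integral_pairing_add_eq_of_endpoints_eq_zero hA.continuous
      (hμt.of_le (by simp)) (hY.of_le (by simp)) h₀ h₁]
    refine intervalIntegral.integral_congr fun t _ => ?_
    simp [A, hY']
  constructor
  · intro h t htI v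
    have hB : ContDiff ℝ (⊤ : ℕ∞) fun t => (A t - deriv μt t) v :=
      (hA.sub hμ').clm_apply contDiff_const
    let X : ℝ × (Fin n → ℝ) → (Fin n → ℝ) := fun z =>
      ((z.1 - t₀) * (t₁ - z.1) * (A z.1 - deriv μt z.1) v) • v
    have hX : ContDiff ℝ (⊤ : ℕ∞) X :=
      (((contDiff_fst.sub contDiff_const).mul (contDiff_const.sub contDiff_fst)).mul
        (hB.comp contDiff_fst)).smul contDiff_const
    have h₀ : X (t₀, q t₀) = 0 := by simp [X]
    have h₁ : X (t₁, q t₁) = 0 := by simp [X]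
    have hzero := eqOn_zero_of_integral_weight_mul_sq_eq_zero ht hB.continuous (by
      rw [← h X hX h₀ h₁, hint X hX h₀ h₁]
      refine intervalIntegral.integral_congr fun t _ => ?_
      simp only [X, map_smul, smul_eq_mul]
      ring) htI
    rw [hderiv]
    exact (sub_eq_zero.1 hzero).symm
  · intro h X hX h₀ h₁
    rw [hint X hX h₀ h₁]
    refine intervalIntegral.integral_zero_ae (.of_forall fun t htI => ?_)
    rw [Set.uIoc_of_le ht.le] at htI
    have := h t (Set.Ioc_subset_Icc_self htI) (X (t, q t))
    rw [hderiv] at this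
    simp [A, this]
end

section
/- Let 𝔤 be a finite-dimensional real Lie algebra endowed with a norm making it a normed vector space, let l : 𝔤 → ℝ be smooth, let t₀ < t₁, and let ξ : [t₀,t₁] → 𝔤 be smooth. Then the following are equivalent: (a) for every smooth curve η : [t₀,t₁] → 𝔤 with η(t₀) = 0 and η(t₁) = 0, ∫_{t₀}^{t₁} dl(ξ(t))( η'(t) + [ξ(t), η(t)] ) dt = 0; (b) ξ satisfies the Euler–Poincaré equations: for every η₀ ∈ 𝔤 and every t ∈ [t₀,t₁], d/dt[ dl(ξ(t))(η₀) ] = dl(ξ(t))( [ξ(t), η₀] ). -/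
open Set

/-- A smooth real function whose integral against every smooth function vanishing at the
endpoints of an interval is zero vanishes on that interval. -/
theorem ContDiff.eqOn_zero_of_forall_integral_mul_eq_zero {f : ℝ → ℝ}
    (hf : ContDiff ℝ (⊤ : ℕ∞) f) {a b : ℝ} (hab : a < b)
    (h : ∀ φ : ℝ → ℝ, ContDiff ℝ (⊤ : ℕ∞) φ → φ a = 0 → φ b = 0 →
      ∫ t in a..b, φ t * f t = 0) :
    EqOn f 0 (Icc a b) := by
  have hIoo : Ioo a b ⊆ {t | f t = 0} := by
    intro t ht
    by_contra hft
    have hφ : ContDiff ℝ (⊤ : ℕ∞) fun s => (s - a) * (b - s) * f s := by fun_prop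
    refine (intervalIntegral.integral_pos (f := fun s => (s - a) * (b - s) * f s * f s) hab
      (hφ.continuous.mul hf.continuous).continuousOn (fun s hs => ?_)
      ⟨t, Ioo_subset_Icc_self ht, ?_⟩).ne' (h _ hφ (by simp) (by simp))
    · rw [mul_assoc]
      exact mul_nonneg (mul_nonneg (sub_nonneg.2 hs.1.le) (sub_nonneg.2 hs.2))
        (mul_self_nonneg _)
    · rw [mul_assoc]
      exact mul_pos (mul_pos (sub_pos.2 ht.1) (sub_pos.2 ht.2)) (mul_self_pos.2 hft)
  have hclosed : IsClosed {t | f t = 0} := isClosed_eq hf.continuous continuous_const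
  rw [← closure_Ioo hab.ne]
  exact closure_minimal hIoo hclosed

/-- Integration by parts for the duality pairing of a curve of functionals with a curve of vectors
vanishing at the endpoints, with an additional term `r` paired with the latter curve. -/
theorem integral_clm_apply_deriv_add {E : Type*} [NormedAddCommGroup E] [NormedSpace ℝ E]
    {p r : ℝ → E →L[ℝ] ℝ} {η : ℝ → E} {a b : ℝ} (hp : ContDiff ℝ 1 p) (hr : Continuous r)
    (hη : ContDiff ℝ 1 η) (ha : η a = 0) (hb : η b = 0) :
    ∫ t in a..b, (p t (deriv η t) + r t (η t)) = ∫ t in a..b, (r t - deriv p t) (η t) := by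
  have hp' : Continuous (deriv p) := hp.continuous_deriv le_rfl
  have hη' : Continuous (deriv η) := hη.continuous_deriv le_rfl
  have hpc := hp.continuous
  have hηc := hη.continuous
  have hparts : ∫ t in a..b, (deriv p t (η t) + p t (deriv η t)) = p b (η b) - p a (η a) := by
    refine intervalIntegral.integral_eq_sub_of_hasDerivAt (f := fun t => p t (η t))
      (fun t _ => ?_) ((by fun_prop : Continuous _).intervalIntegrable _ _)
    exact (hp.differentiable one_ne_zero t).hasDerivAt.clm_apply
      (hη.differentiable one_ne_zero t).hasDerivAt
  rw [← sub_eq_zero, ← intervalIntegral.integral_sub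
    ((by fun_prop : Continuous _).intervalIntegrable _ _)
    ((by fun_prop : Continuous _).intervalIntegrable _ _)]
  simp only [ha, hb, map_zero, sub_zero] at hparts
  rw [← hparts]
  congr 1 with t
  simp only [sub_apply]
  ring


/-- Euler–Poincaré: for a finite-dimensional normed real Lie algebra `𝔤`
(with bilinear bracket satisfying alternativity and the Jacobi identity) and a smooth
Lagrangian `l : 𝔤 → ℝ`, a smooth curve `ξ` satisfies the variational principle
`∫ dl(ξ)(η̇ + [ξ, η]) dt = 0` for all smooth curves `η` vanishing at the endpoints iff
it satisfies the Euler–Poincaré equations `d/dt(dl(ξ)(η₀)) = dl(ξ)([ξ, η₀])`. -/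
theorem variational_iff_euler_poincare (𝔤 : Type*)
    [NormedAddCommGroup 𝔤] [NormedSpace ℝ 𝔤] [FiniteDimensional ℝ 𝔤]
    (bracket : 𝔤 →ₗ[ℝ] 𝔤 →ₗ[ℝ] 𝔤)
    (halt : ∀ x : 𝔤, bracket x x = 0)
    (hjac : ∀ x y z : 𝔤,
      bracket x (bracket y z) + bracket y (bracket z x) + bracket z (bracket x y) = 0)
    (l : 𝔤 → ℝ) (hl : ContDiff ℝ (⊤ : ℕ∞) l)
    (t₀ t₁ : ℝ) (ht : t₀ < t₁)
    (ξ : ℝ → 𝔤) (hξ : ContDiff ℝ (⊤ : ℕ∞) ξ) :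
    (∀ η : ℝ → 𝔤, ContDiff ℝ (⊤ : ℕ∞) η → η t₀ = 0 → η t₁ = 0 →
        ∫ t in t₀..t₁, fderiv ℝ l (ξ t) (deriv η t + bracket (ξ t) (η t)) = 0) ↔
      (∀ η₀ : 𝔤, ∀ t ∈ Set.Icc t₀ t₁,
        deriv (fun s => fderiv ℝ l (ξ s) η₀) t =
          fderiv ℝ l (ξ t) (bracket (ξ t) η₀)) := by
  let B : 𝔤 →L[ℝ] 𝔤 →L[ℝ] 𝔤 :=
    LinearMap.toContinuousLinearMap (LinearMap.toContinuousLinearMap.toLinearMap ∘ₗ bracket)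
  have hB : ∀ x y, bracket x y = B x y := fun _ _ => rfl
  let p : ℝ → 𝔤 →L[ℝ] ℝ := fun t => fderiv ℝ l (ξ t)
  let r : ℝ → 𝔤 →L[ℝ] ℝ := fun t => (p t).comp (B (ξ t))
  have hp : ContDiff ℝ (⊤ : ℕ∞) p := (hl.fderiv_right (by simp)).comp hξ
  have hr : ContDiff ℝ (⊤ : ℕ∞) r := hp.clm_comp (B.contDiff.comp hξ)
  have hp' : ContDiff ℝ (⊤ : ℕ∞) (deriv p) := (contDiff_infty_iff_deriv.1 hp).2
  have hone : (1 : WithTop ℕ∞) ≤ ((⊤ : ℕ∞) : WithTop ℕ∞) := by simp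
  have hderiv : ∀ η₀ t, deriv (fun s => fderiv ℝ l (ξ s) η₀) t = deriv p t η₀ := by
    intro η₀ t
    simpa using ((hp.differentiable (by simp) t).hasDerivAt.clm_apply
      (hasDerivAt_const t η₀)).deriv
  have hint : ∀ η : ℝ → 𝔤, ContDiff ℝ (⊤ : ℕ∞) η → η t₀ = 0 → η t₁ = 0 →
      ∫ t in t₀..t₁, fderiv ℝ l (ξ t) (deriv η t + bracket (ξ t) (η t)) =
        ∫ t in t₀..t₁, (r t - deriv p t) (η t) := by
    intro η hη h₀ h₁
    rw [← integral_clm_apply_deriv_add (hp.of_le hone) hr.continuous (hη.of_le hone) h₀ h₁]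
    simp only [map_add]
    rfl
  constructor
  · intro h η₀ t htI
    have hzero := ContDiff.eqOn_zero_of_forall_integral_mul_eq_zero
      (f := fun t => (r t - deriv p t) η₀) ((hr.sub hp').clm_apply contDiff_const) ht
      (fun φ hφ h₀ h₁ => by
        have hη : ContDiff ℝ (⊤ : ℕ∞) fun t => φ t • η₀ := hφ.smul contDiff_const
        have := (hint _ hη (by simp [h₀]) (by simp [h₁])).symm.trans
          (h _ hη (by simp [h₀]) (by simp [h₁]))
        simpa only [map_smul, smul_eq_mul] using this) htI
    rw [hderiv]
    exact (sub_eq_zero.1 hzero).symm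
  · intro h η hη h₀ h₁
    rw [hint η hη h₀ h₁]
    refine (intervalIntegral.integral_congr fun t htI => ?_).trans intervalIntegral.integral_zero
    rw [uIcc_of_le ht.le] at htI
    have := h (η t) t htI
    rw [hderiv] at this
    exact sub_eq_zero.2 this.symm
end

section
/- Let 𝔤 be a finite-dimensional real Lie algebra endowed with a norm making it a normed vector space, with continuous dual 𝔤*, let H : 𝔤* → ℝ be smooth, and let δH : 𝔤* → 𝔤 be the (unique) map satisfying dH(μ)(β) = β(δH(μ)) for all μ, β ∈ 𝔤*, assumed smooth. Let t₀ < t₁ and let α : [t₀,t₁] → 𝔤* be smooth. Then the following are equivalent: (a) for every smooth curve η : [t₀,t₁] → 𝔤 with η(t₀) = 0 and η(t₁) = 0, ∫_{t₀}^{t₁} α(t)( η'(t) + [δH(α(t)), η(t)] ) dt = 0; (b) α satisfies the Lie–Poisson equations: for every η₀ ∈ 𝔤 and every t ∈ [t₀,t₁], d/dt[ α(t)(η₀) ] = α(t)( [δH(α(t)), η₀] ). -/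
/-- Integration by parts for the pairing of a curve of functionals with a curve of vectors
vanishing at both ends. -/
theorem integral_pairing_deriv_add_eq_neg {E : Type*} [NormedAddCommGroup E] [NormedSpace ℝ E]
    {a b : ℝ} {α ξ : ℝ → (E →L[ℝ] ℝ)} {η : ℝ → E}
    (hα : ContDiff ℝ 1 α) (hξ : Continuous ξ) (hη : ContDiff ℝ 1 η)
    (ha : η a = 0) (hb : η b = 0) :
    ∫ t in a..b, (α t (deriv η t) + ξ t (η t)) = -∫ t in a..b, (deriv α t - ξ t) (η t) := by
  have hα' : Continuous (deriv α) := hα.continuous_deriv le_rfl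
  have hη' : Continuous (deriv η) := hη.continuous_deriv le_rfl
  have hc₁ : Continuous fun t => α t (deriv η t) + ξ t (η t) :=
    (hα.continuous.clm_apply hη').add (hξ.clm_apply hη.continuous)
  have hc₂ : Continuous fun t => (deriv α t - ξ t) (η t) :=
    (hα'.sub hξ).clm_apply hη.continuous
  have hd : ∀ t, HasDerivAt (fun s => α s (η s))
      (α t (deriv η t) + ξ t (η t) + (deriv α t - ξ t) (η t)) t := fun t => by
    have h := ((hα.differentiable one_ne_zero) t).hasDerivAt.clm_apply
      ((hη.differentiable one_ne_zero) t).hasDerivAt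
    refine h.congr_deriv ?_
    rw [sub_apply]
    ring
  have h := intervalIntegral.integral_eq_sub_of_hasDerivAt (a := a) (b := b) (fun t _ => hd t)
    ((hc₁.add hc₂).intervalIntegrable a b)
  rw [intervalIntegral.integral_add (hc₁.intervalIntegrable a b) (hc₂.intervalIntegrable a b),
    ha, hb, map_zero, map_zero, sub_zero] at h
  exact eq_neg_of_add_eq_zero_left h

/-- A continuous function whose square has zero integral against `(t - a) * (b - t)` vanishes
on `[a, b]`. -/
theorem eq_zero_of_integral_mul_sq_eq_zero {a b : ℝ} (hab : a < b) {f : ℝ → ℝ}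
    (hf : Continuous f) (h : ∫ t in a..b, (t - a) * (b - t) * f t ^ 2 = 0) :
    ∀ t ∈ Set.Icc a b, f t = 0 := by
  have hIoo : Set.EqOn f 0 (Set.Ioo a b) := by
    intro t ht
    by_contra hne
    have hne : f t ≠ 0 := hne
    refine (intervalIntegral.integral_pos hab
      (f := fun t => (t - a) * (b - t) * f t ^ 2) (by fun_prop) (fun x hx => ?_)
      ⟨t, Set.Ioo_subset_Icc_self ht, ?_⟩).ne' h
    · exact mul_nonneg (mul_nonneg (sub_nonneg.2 hx.1.le) (sub_nonneg.2 hx.2)) (sq_nonneg _)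
    · have := sub_pos.2 ht.1
      have := sub_pos.2 ht.2
      positivity
  have hcl := hIoo.closure hf continuous_zero
  rw [closure_Ioo hab.ne] at hcl
  exact hcl


/-- Lie–Poisson: for a finite-dimensional normed real Lie algebra `𝔤`, a smooth
Hamiltonian `H : 𝔤* → ℝ` with functional derivative `δH : 𝔤* → 𝔤`
(`dH(μ)(β) = β(δH(μ))`), a smooth curve `α` in `𝔤*` satisfies the variational principle
`∫ α(η̇ + [δH(α), η]) dt = 0` for all smooth curves `η` in `𝔤` vanishing at the
endpoints iff it satisfies the Lie–Poisson equations
`d/dt(α(η₀)) = α([δH(α), η₀])`, i.e. `α̇ = ad*_{δH(α)} α`. -/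
theorem variational_iff_lie_poisson (𝔤 : Type*)
    [NormedAddCommGroup 𝔤] [NormedSpace ℝ 𝔤] [FiniteDimensional ℝ 𝔤]
    (bracket : 𝔤 →ₗ[ℝ] 𝔤 →ₗ[ℝ] 𝔤)
    (halt : ∀ x : 𝔤, bracket x x = 0)
    (hjac : ∀ x y z : 𝔤,
      bracket x (bracket y z) + bracket y (bracket z x) + bracket z (bracket x y) = 0)
    (H : (𝔤 →L[ℝ] ℝ) → ℝ) (hH : ContDiff ℝ (⊤ : ℕ∞) H)
    (δH : (𝔤 →L[ℝ] ℝ) → 𝔤) (hδH : ContDiff ℝ (⊤ : ℕ∞) δH)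
    (hδ : ∀ μ β : 𝔤 →L[ℝ] ℝ, fderiv ℝ H μ β = β (δH μ))
    (t₀ t₁ : ℝ) (ht : t₀ < t₁)
    (α : ℝ → (𝔤 →L[ℝ] ℝ)) (hα : ContDiff ℝ (⊤ : ℕ∞) α) :
    (∀ η : ℝ → 𝔤, ContDiff ℝ (⊤ : ℕ∞) η → η t₀ = 0 → η t₁ = 0 →
        ∫ t in t₀..t₁, α t (deriv η t + bracket (δH (α t)) (η t)) = 0) ↔
      (∀ η₀ : 𝔤, ∀ t ∈ Set.Icc t₀ t₁,
        deriv (fun s => α s η₀) t = α t (bracket (δH (α t)) η₀)) := by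
  let B : 𝔤 →L[ℝ] 𝔤 →L[ℝ] 𝔤 := bracket.toContinuousBilinearMap
  have hB : ∀ x y, bracket x y = B x y := fun _ _ => rfl
  let ξ : ℝ → (𝔤 →L[ℝ] ℝ) := fun t => (α t).comp (B (δH (α t)))
  have hξ : ContDiff ℝ (⊤ : ℕ∞) ξ := hα.clm_comp (B.contDiff.comp (hδH.comp hα))
  have hα₁ : ContDiff ℝ 1 α := hα.of_le (mod_cast le_top)
  have hα' : ContDiff ℝ (⊤ : ℕ∞) (deriv α) := (contDiff_infty_iff_deriv.1 hα).2
  have hderiv : ∀ (v : 𝔤) (t : ℝ), deriv (fun s => α s v) t = deriv α t v := fun v t => by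
    have h := ((hα₁.differentiable one_ne_zero) t).hasDerivAt.clm_apply (hasDerivAt_const t v)
    simpa using h.deriv
  have hparts : ∀ η : ℝ → 𝔤, ContDiff ℝ (⊤ : ℕ∞) η → η t₀ = 0 → η t₁ = 0 →
      ∫ t in t₀..t₁, α t (deriv η t + bracket (δH (α t)) (η t)) =
        -∫ t in t₀..t₁, (deriv α t - ξ t) (η t) := fun η hη h₀ h₁ => by
    rw [← integral_pairing_deriv_add_eq_neg hα₁ hξ.continuous (hη.of_le (mod_cast le_top)) h₀ h₁]
    simp only [map_add, hB, ξ, ContinuousLinearMap.comp_apply]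
  constructor
  · intro h v t htt
    let f : ℝ → ℝ := fun s => (deriv α s - ξ s) v
    have hf : ContDiff ℝ (⊤ : ℕ∞) f := (hα'.sub hξ).clm_apply contDiff_const
    have hη : ContDiff ℝ (⊤ : ℕ∞) fun s => ((s - t₀) * (t₁ - s) * f s) • v :=
      (((contDiff_id.sub contDiff_const).mul (contDiff_const.sub contDiff_id)).mul hf).smul
        contDiff_const
    have h₀ := h _ hη (by simp) (by simp)
    rw [hparts _ hη (by simp) (by simp), neg_eq_zero] at h₀
    have hft : f t = 0 := by
      refine eq_zero_of_integral_mul_sq_eq_zero ht hf.continuous ?_ t htt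
      rw [← h₀]
      refine intervalIntegral.integral_congr fun s _ => ?_
      simp only [map_smul, smul_eq_mul, f]
      ring
    rw [hderiv, hB]
    exact sub_eq_zero.1 hft
  · intro h η hη h₀ h₁
    rw [hparts η hη h₀ h₁, neg_eq_zero]
    refine intervalIntegral.integral_zero_ae (Filter.Eventually.of_forall fun t htt => ?_)
    rw [Set.uIoc_of_le ht.le] at htt
    have := h (η t) t (Set.Ioc_subset_Icc_self htt)
    rw [hderiv, hB] at this
    exact sub_eq_zero.2 this
end

section
/- Let n, m ∈ ℕ, let ρ : ℝⁿ → L(ℝᵐ, ℝⁿ) be a smooth anchor map, and let C^C_{AB} : ℝⁿ → ℝ (1 ≤ A,B,C ≤ m) be smooth structure functions with C^C_{AB} = −C^C_{BA}. Let L : ℝⁿ × ℝᵐ → ℝ be smooth, let t₀ < t₁, and let t ↦ (q(t), y(t)) be a smooth admissible curve, i.e. q'(t) = ρ(q(t))y(t) for all t. Then the following are equivalent: (a) for every smooth time-dependent section X̃ : ℝ × ℝⁿ → ℝᵐ with X̃(t₀,q(t₀)) = 0 and X̃(t₁,q(t₁)) = 0, ∫_{t₀}^{t₁} [ D₁L(q(t),y(t))(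 ρ(q(t))X̃(t,q(t)) ) + D₂L(q(t),y(t))( ∂X̃/∂t(t,q(t)) + D_qX̃(t,q(t))(ρ(q(t))y(t)) − C(q(t))(X̃(t,q(t)), y(t)) ) ] dt = 0; (b) for all t and all A, d/dt[ ∂L/∂y^A(q(t),y(t)) ] − Σ_i ρ^i_A(q(t)) ∂L/∂q^i(q(t),y(t)) + Σ_{B,C} C^C_{AB}(q(t)) y^B(t) ∂L/∂y^C(q(t),y(t)) = 0 (the Euler–Lagrange equations on the skew-symmetric algebroid). -/
open Set

/-- The Euler–Lagrange expression
`d/dt(∂L/∂y^A) − ρ^i_A ∂L/∂q^i + C^C_{AB} y^B ∂L/∂y^C` along the curve `(q, y)`. -/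
noncomputable def eulerLagrangeExpr {n m : ℕ} (ρ : (Fin n → ℝ) → Fin n → Fin m → ℝ)
    (C : Fin m → Fin m → Fin m → (Fin n → ℝ) → ℝ)
    (L : ((Fin n → ℝ) × (Fin m → ℝ)) → ℝ) (q : ℝ → Fin n → ℝ) (y : ℝ → Fin m → ℝ)
    (t : ℝ) (A : Fin m) : ℝ :=
  deriv (fun s => fderiv ℝ L (q s, y s) (0, Pi.single A 1)) t -
    (∑ i, ρ (q t) i A * fderiv ℝ L (q t, y t) (Pi.single i 1, 0)) +
    (∑ B, ∑ c, C c A B (q t) * y t B * fderiv ℝ L (q t, y t) (0, Pi.single c 1))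

lemma clm_apply_inl_eq_sum {n m : ℕ} (f : ((Fin n → ℝ) × (Fin m → ℝ)) →L[ℝ] ℝ)
    (u : Fin n → ℝ) : f (u, 0) = ∑ i, u i * f (Pi.single i 1, 0) := by
  have h := congrArg (f.comp (ContinuousLinearMap.inl ℝ _ _)) (pi_eq_sum_univ' u)
  simp only [map_sum, map_smul] at h
  exact h

lemma clm_apply_inr_eq_sum {n m : ℕ} (f : ((Fin n → ℝ) × (Fin m → ℝ)) →L[ℝ] ℝ)
    (v : Fin m → ℝ) : f (0, v) = ∑ c, v c * f (0, Pi.single c 1) := by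
  have h := congrArg (f.comp (ContinuousLinearMap.inr ℝ _ _)) (pi_eq_sum_univ' v)
  simp only [map_sum, map_smul] at h
  exact h

section

variable {n m : ℕ} {ρ : (Fin n → ℝ) → Fin n → Fin m → ℝ}
  {C : Fin m → Fin m → Fin m → (Fin n → ℝ) → ℝ}
  {L : ((Fin n → ℝ) × (Fin m → ℝ)) → ℝ} {q : ℝ → Fin n → ℝ} {y : ℝ → Fin m → ℝ}

lemma contDiff_fderiv_apply_along (hL : ContDiff ℝ (⊤ : ℕ∞) L) (hq : ContDiff ℝ (⊤ : ℕ∞) q)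
    (hy : ContDiff ℝ (⊤ : ℕ∞) y) (v : (Fin n → ℝ) × (Fin m → ℝ)) :
    ContDiff ℝ (⊤ : ℕ∞) fun t => fderiv ℝ L (q t, y t) v :=
  ((hL.fderiv_right (m := (⊤ : ℕ∞)) (by simp)).comp (hq.prodMk hy)).clm_apply contDiff_const

lemma contDiff_eulerLagrangeExpr (hρ : ContDiff ℝ (⊤ : ℕ∞) ρ)
    (hC : ∀ c a b, ContDiff ℝ (⊤ : ℕ∞) (C c a b)) (hL : ContDiff ℝ (⊤ : ℕ∞) L)
    (hq : ContDiff ℝ (⊤ : ℕ∞) q) (hy : ContDiff ℝ (⊤ : ℕ∞) y) :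
    ContDiff ℝ (⊤ : ℕ∞) (eulerLagrangeExpr ρ C L q y) := by
  refine contDiff_pi.2 fun A => ?_
  unfold eulerLagrangeExpr
  refine ((contDiff_infty_iff_deriv.1 (contDiff_fderiv_apply_along hL hq hy _)).2.sub
    (ContDiff.sum fun i _ => ContDiff.mul ?_ (contDiff_fderiv_apply_along hL hq hy _))).add
    (ContDiff.sum fun B _ => ContDiff.sum fun c _ =>
      (((hC c A B).comp hq).mul (contDiff_pi.1 hy B)).mul
        (contDiff_fderiv_apply_along hL hq hy _))
  exact contDiff_pi.1 (contDiff_pi.1 (hρ.comp hq) i) A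

/-- Along an admissible curve, the pairing of `dL` with the tangent lift of a section differs
from the total derivative of the momentum pairing by the Euler–Lagrange expression. -/
lemma tangentLift_pairing_eq (hL : ContDiff ℝ (⊤ : ℕ∞) L) (hq : ContDiff ℝ (⊤ : ℕ∞) q)
    (hy : ContDiff ℝ (⊤ : ℕ∞) y) {Xt : (ℝ × (Fin n → ℝ)) → (Fin m → ℝ)}
    (hX : ContDiff ℝ (⊤ : ℕ∞) Xt) {t : ℝ}
    (hadm : deriv q t = fun i => ∑ A, ρ (q t) i A * y t A) :
    fderiv ℝ L (q t, y t) ((fun i => ∑ A, ρ (q t) i A * Xt (t, q t) A), 0) +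
      fderiv ℝ L (q t, y t)
        (0, fun c =>
          fderiv ℝ Xt (t, q t) (1, 0) c +
            fderiv ℝ Xt (t, q t) (0, fun i => ∑ A, ρ (q t) i A * y t A) c -
            ∑ A, ∑ B, C c A B (q t) * Xt (t, q t) A * y t B) =
      deriv (fun s => ∑ A, fderiv ℝ L (q s, y s) (0, Pi.single A 1) * Xt (s, q s) A) t -
        ∑ A, Xt (t, q t) A * eulerLagrangeExpr ρ C L q y t A := by
  have hqd : HasDerivAt q (deriv q t) t := (hq.differentiable (by simp) t).hasDerivAt
  have hXd : HasDerivAt (fun s => Xt (s, q s)) (fderiv ℝ Xt (t, q t) (1, deriv q t)) t :=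
    (hX.differentiable (by simp) (t, q t)).hasFDerivAt.comp_hasDerivAt t
      ((hasDerivAt_id t).prodMk hqd)
  have hp (A : Fin m) := ((contDiff_fderiv_apply_along hL hq hy (0, Pi.single A 1)).differentiable
    (by simp) t).hasDerivAt
  have hF := HasDerivAt.fun_sum (u := Finset.univ)
    fun A _ => (hp A).mul (hasDerivAt_pi.1 hXd A)
  have hsplit : fderiv ℝ Xt (t, q t) (1, deriv q t) =
      fderiv ℝ Xt (t, q t) (1, 0) + fderiv ℝ Xt (t, q t) (0, deriv q t) := by
    rw [← map_add]; simp
  refine Eq.trans ?_ (congrArg (· - _) hF.deriv.symm)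
  rw [← hadm, clm_apply_inl_eq_sum, clm_apply_inr_eq_sum, hsplit]
  simp only [eulerLagrangeExpr, Pi.add_apply]
  have h₁ : ∑ i, (∑ A, ρ (q t) i A * Xt (t, q t) A) * fderiv ℝ L (q t, y t) (Pi.single i 1, 0) =
      ∑ A, Xt (t, q t) A * ∑ i, ρ (q t) i A * fderiv ℝ L (q t, y t) (Pi.single i 1, 0) := by
    simp only [Finset.sum_mul, Finset.mul_sum]
    rw [Finset.sum_comm]
    exact Finset.sum_congr rfl fun _ _ => Finset.sum_congr rfl fun _ _ => by ring
  have h₂ : ∑ c, (∑ A, ∑ B, C c A B (q t) * Xt (t, q t) A * y t B) *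
        fderiv ℝ L (q t, y t) (0, Pi.single c 1) =
      ∑ A, Xt (t, q t) A *
        ∑ B, ∑ c, C c A B (q t) * y t B * fderiv ℝ L (q t, y t) (0, Pi.single c 1) := by
    simp only [Finset.sum_mul, Finset.mul_sum]
    rw [Finset.sum_comm]
    refine Finset.sum_congr rfl fun A _ => ?_
    rw [Finset.sum_comm]
    exact Finset.sum_congr rfl fun _ _ => Finset.sum_congr rfl fun _ _ => by ring
  simp only [sub_mul, Finset.sum_sub_distrib]
  rw [h₁, h₂, ← Finset.sum_sub_distrib, ← Finset.sum_sub_distrib, ← Finset.sum_add_distrib]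
  exact Finset.sum_congr rfl fun _ _ => by ring

/-- First variation formula: for sections vanishing at the endpoints, the variation of the action
is minus the integrated pairing with the Euler–Lagrange expression. -/
lemma integral_tangentLift_pairing_eq (hρ : ContDiff ℝ (⊤ : ℕ∞) ρ)
    (hC : ∀ c a b, ContDiff ℝ (⊤ : ℕ∞) (C c a b)) (hL : ContDiff ℝ (⊤ : ℕ∞) L)
    (hq : ContDiff ℝ (⊤ : ℕ∞) q) (hy : ContDiff ℝ (⊤ : ℕ∞) y) {t₀ t₁ : ℝ} (ht : t₀ ≤ t₁)
    (hadm : ∀ t ∈ Icc t₀ t₁, deriv q t = fun i => ∑ A, ρ (q t) i A * y t A)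
    {Xt : (ℝ × (Fin n → ℝ)) → (Fin m → ℝ)} (hX : ContDiff ℝ (⊤ : ℕ∞) Xt)
    (h₀ : Xt (t₀, q t₀) = 0) (h₁ : Xt (t₁, q t₁) = 0) :
    ∫ t in t₀..t₁,
      (fderiv ℝ L (q t, y t) ((fun i => ∑ A, ρ (q t) i A * Xt (t, q t) A), 0) +
        fderiv ℝ L (q t, y t)
          (0, fun c =>
            fderiv ℝ Xt (t, q t) (1, 0) c +
              fderiv ℝ Xt (t, q t) (0, fun i => ∑ A, ρ (q t) i A * y t A) c -
              ∑ A, ∑ B, C c A B (q t) * Xt (t, q t) A * y t B)) =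
      -∫ t in t₀..t₁, ∑ A, Xt (t, q t) A * eulerLagrangeExpr ρ C L q y t A := by
  have hXq : ContDiff ℝ (⊤ : ℕ∞) fun t => Xt (t, q t) := hX.comp (contDiff_id.prodMk hq)
  have hF : ContDiff ℝ (⊤ : ℕ∞)
      fun s => ∑ A, fderiv ℝ L (q s, y s) (0, Pi.single A 1) * Xt (s, q s) A :=
    ContDiff.sum fun A _ => (contDiff_fderiv_apply_along hL hq hy _).mul (contDiff_pi.1 hXq A)
  have hE := contDiff_eulerLagrangeExpr hρ hC hL hq hy
  have hXE : Continuous fun t => ∑ A, Xt (t, q t) A * eulerLagrangeExpr ρ C L q y t A :=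
    (ContDiff.sum fun A _ => (contDiff_pi.1 hXq A).mul (contDiff_pi.1 hE A)).continuous
  have hF' := (contDiff_infty_iff_deriv.1 hF).2.continuous
  rw [intervalIntegral.integral_congr fun t hmem =>
      tangentLift_pairing_eq hL hq hy hX (hadm t (uIcc_of_le ht ▸ hmem)),
    intervalIntegral.integral_sub (hF'.intervalIntegrable _ _) (hXE.intervalIntegrable _ _),
    intervalIntegral.integral_deriv_eq_sub (fun t _ => hF.differentiable (by simp) t)
      (hF'.intervalIntegrable _ _)]
  simp [h₀, h₁]

end


/-- Lagrangian mechanics on a (local, trivialized) skew-symmetric algebroid with anchor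
`ρ` and structure functions `C^C_{AB}`: an admissible curve (`q̇ = ρ(q)y`) satisfies the
generalized variational principle `∫ ⟨dL(q,y), X^T⟩ dt = 0` for all time-dependent
sections vanishing at the endpoints iff it satisfies the Euler–Lagrange equations
`d/dt(∂L/∂y^A) − ρ^i_A ∂L/∂q^i + C^C_{AB} y^B ∂L/∂y^C = 0`. -/
theorem algebroid_variational_iff_euler_lagrange (n m : ℕ)
    (ρ : (Fin n → ℝ) → Fin n → Fin m → ℝ) (hρ : ContDiff ℝ (⊤ : ℕ∞) ρ)
    (C : Fin m → Fin m → Fin m → (Fin n → ℝ) → ℝ)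
    (hCsmooth : ∀ c a b, ContDiff ℝ (⊤ : ℕ∞) (C c a b))
    (hCskew : ∀ (c a b : Fin m) (x : Fin n → ℝ), C c a b x = -C c b a x)
    (L : ((Fin n → ℝ) × (Fin m → ℝ)) → ℝ) (hL : ContDiff ℝ (⊤ : ℕ∞) L)
    (t₀ t₁ : ℝ) (ht : t₀ < t₁)
    (q : ℝ → Fin n → ℝ) (hq : ContDiff ℝ (⊤ : ℕ∞) q)
    (y : ℝ → Fin m → ℝ) (hy : ContDiff ℝ (⊤ : ℕ∞) y)
    (hadm : ∀ t ∈ Set.Icc t₀ t₁, deriv q t = fun i => ∑ A, ρ (q t) i A * y t A) :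
    (∀ Xt : (ℝ × (Fin n → ℝ)) → (Fin m → ℝ), ContDiff ℝ (⊤ : ℕ∞) Xt →
        Xt (t₀, q t₀) = 0 → Xt (t₁, q t₁) = 0 →
        ∫ t in t₀..t₁,
          (fderiv ℝ L (q t, y t) ((fun i => ∑ A, ρ (q t) i A * Xt (t, q t) A), 0) +
            fderiv ℝ L (q t, y t)
              (0, fun c =>
                fderiv ℝ Xt (t, q t) (1, 0) c +
                  fderiv ℝ Xt (t, q t) (0, fun i => ∑ A, ρ (q t) i A * y t A) c -
                  ∑ A, ∑ B, C c A B (q t) * Xt (t, q t) A * y t B)) = 0) ↔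
      (∀ t ∈ Set.Icc t₀ t₁, ∀ A : Fin m,
        deriv (fun s => fderiv ℝ L (q s, y s) (0, Pi.single A 1)) t -
          (∑ i, ρ (q t) i A * fderiv ℝ L (q t, y t) (Pi.single i 1, 0)) +
          (∑ B, ∑ c, C c A B (q t) * y t B * fderiv ℝ L (q t, y t) (0, Pi.single c 1)) =
          0) := by
  have hE := contDiff_eulerLagrangeExpr hρ hCsmooth hL hq hy
  have hvar {Xt : (ℝ × (Fin n → ℝ)) → (Fin m → ℝ)} (hX : ContDiff ℝ (⊤ : ℕ∞) Xt)
      (h₀ : Xt (t₀, q t₀) = 0) (h₁ : Xt (t₁, q t₁) = 0) :=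
    integral_tangentLift_pairing_eq hρ hCsmooth hL hq hy ht.le hadm hX h₀ h₁
  change _ ↔ ∀ t ∈ Icc t₀ t₁, ∀ A, eulerLagrangeExpr ρ C L q y t A = 0
  constructor
  · intro h
    have hX : ContDiff ℝ (⊤ : ℕ∞) fun z : ℝ × (Fin n → ℝ) =>
        ((z.1 - t₀) * (t₁ - z.1)) • eulerLagrangeExpr ρ C L q y z.1 :=
      ((contDiff_fst.sub contDiff_const).mul (contDiff_const.sub contDiff_fst)).smul
        (hE.comp contDiff_fst)
    have hint := h _ hX (by simp) (by simp)
    rw [hvar hX (by simp) (by simp), neg_eq_zero] at hint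
    have hcont : Continuous fun t => ∑ A, (((t - t₀) * (t₁ - t)) • eulerLagrangeExpr ρ C L q y t) A *
        eulerLagrangeExpr ρ C L q y t A := by
      have := hE.continuous
      fun_prop
    have hnonneg : ∀ t ∈ Icc t₀ t₁, 0 ≤ ∑ A,
        (((t - t₀) * (t₁ - t)) • eulerLagrangeExpr ρ C L q y t) A *
          eulerLagrangeExpr ρ C L q y t A := fun t hmem => by
      refine Finset.sum_nonneg fun A _ => ?_
      rw [Pi.smul_apply, smul_eq_mul, mul_assoc]
      exact mul_nonneg (mul_nonneg (sub_nonneg.2 hmem.1) (sub_nonneg.2 hmem.2))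
        (mul_self_nonneg _)
    have hIoo : ∀ t ∈ Ioo t₀ t₁, eulerLagrangeExpr ρ C L q y t = 0 := by
      intro t hmem
      have hmem' := Ioo_subset_Icc_self hmem
      have hzero := (hnonneg t hmem').eq_of_not_lt fun hpos =>
        (intervalIntegral.integral_pos ht hcont.continuousOn
          (fun s hs => hnonneg s (Ioc_subset_Icc_self hs)) ⟨t, hmem', hpos⟩).ne' hint
      have hw : (t - t₀) * (t₁ - t) ≠ 0 :=
        (mul_pos (sub_pos.2 hmem.1) (sub_pos.2 hmem.2)).ne'
      simp only [Pi.smul_apply, smul_eq_mul, mul_assoc _ (eulerLagrangeExpr ρ C L q y t _),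
        ← Finset.mul_sum] at hzero
      have hsum := (mul_eq_zero.1 hzero.symm).resolve_left hw
      rw [Finset.sum_eq_zero_iff_of_nonneg fun _ _ => mul_self_nonneg _] at hsum
      exact funext fun A => mul_self_eq_zero.1 (hsum A (Finset.mem_univ A))
    intro t hmem A
    rw [← closure_Ioo ht.ne] at hmem
    exact congrFun ((isClosed_eq hE.continuous continuous_const).closure_subset_iff.2 hIoo hmem) A
  · intro h Xt hX h₀ h₁
    rw [hvar hX h₀ h₁, neg_eq_zero]
    refine intervalIntegral.integral_zero_ae (.of_forall fun t hmem => ?_)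
    rw [uIoc_of_le ht.le] at hmem
    simp [h t (Ioc_subset_Icc_self hmem)]
end

section
/- Let n, m ∈ ℕ, let ρ : ℝⁿ → L(ℝᵐ, ℝⁿ) be a smooth anchor map, and let C^C_{AB} : ℝⁿ → ℝ (1 ≤ A,B,C ≤ m) be smooth structure functions with C^C_{AB} = −C^C_{BA}. Let H : ℝⁿ × ℝᵐ → ℝ be smooth, let t₀ < t₁, and let q : [t₀,t₁] → ℝⁿ and p : [t₀,t₁] → ℝᵐ be smooth curves; set y(t) = ∂H/∂p(q(t),p(t)) ∈ ℝᵐ and assume q'(t) = ρ(q(t))y(t) for all t. Then the following are equivalent: (a) for every smooth time-dependent section X̃ : ℝ × ℝⁿ → ℝᵐ with X̃(t₀,q(t₀)) = 0 and X̃(t₁,q(t₁)) = 0, ∫_{t₀}^{t₁} [ −D₁H(q(t),p(t))( ρ(q(t))X̃(t,q(t)) ) + ⟨ p(t), ∂X̃/∂t(t,q(t)) + D_qX̃(t,q(t))(ρ(q(t))y(t)) − C(q(t))(X̃(t,q(t)), y(t)) ⟩ ] dt = 0; (b) for all t and all A, p'_A(t) = −Σ_i ρ^i_A(q(t)) ∂H/∂q^i(q(t),p(t))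 − Σ_{B,C} C^C_{AB}(q(t)) ∂H/∂p_B(q(t),p(t)) p_C(t) (Hamilton's equations on the skew-symmetric algebroid). -/
/-- A continuous nonnegative weight multiplied by a sum of squares has vanishing integral only if
all the squared functions vanish on the interval. -/
theorem eq_zero_of_integral_weighted_sum_sq_eq_zero {ι : Type*} [Fintype ι] {a b : ℝ} (hab : a < b)
    {F : ℝ → ι → ℝ} (hF : Continuous F)
    (hint : ∫ t in a..b, ∑ i, (t - a) * (b - t) * F t i * F t i = 0) :
    ∀ t ∈ Set.Icc a b, F t = 0 := by
  have hFi : ∀ i, Continuous fun t => F t i := fun i => (continuous_apply i).comp hF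
  have hterm : ∀ t ∈ Set.Icc a b, ∀ i, 0 ≤ (t - a) * (b - t) * F t i * F t i := by
    intro t ht i
    rw [mul_assoc]
    exact mul_nonneg (mul_nonneg (sub_nonneg.2 ht.1) (sub_nonneg.2 ht.2)) (mul_self_nonneg _)
  have hzero : Set.Ioo a b ⊆ {t | F t = 0} := by
    intro t ht
    by_contra hne
    obtain ⟨i, hi⟩ := Function.ne_iff.1 hne
    have hpos : 0 < ∫ t in a..b, ∑ i, (t - a) * (b - t) * F t i * F t i := by
      refine intervalIntegral.integral_pos hab (Continuous.continuousOn (by fun_prop))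
        (fun s hs => Finset.sum_nonneg fun i _ => hterm s (Set.Ioc_subset_Icc_self hs) i)
        ⟨t, Set.Ioo_subset_Icc_self ht, ?_⟩
      refine Finset.sum_pos' (fun i _ => hterm t (Set.Ioo_subset_Icc_self ht) i)
        ⟨i, Finset.mem_univ i, ?_⟩
      rw [mul_assoc]
      exact mul_pos (mul_pos (sub_pos.2 ht.1) (sub_pos.2 ht.2)) (mul_self_pos.2 hi)
    exact hpos.ne' hint
  have hclosed : IsClosed {t | F t = 0} := isClosed_eq hF continuous_const
  rw [← closure_Ioo hab.ne]
  exact hclosed.closure_subset_iff.2 hzero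

/-- A functional of the first variable is evaluated coordinatewise on an anchored vector. -/
theorem map_anchor_eq_sum {n m : ℕ} (L : ((Fin n → ℝ) × (Fin m → ℝ)) →L[ℝ] ℝ)
    (r : Fin n → Fin m → ℝ) (x : Fin m → ℝ) :
    L ((fun i => ∑ A, r i A * x A), 0) = ∑ A, x A * ∑ i, r i A * L (Pi.single i 1, 0) := by
  have h : (((fun i => ∑ A, r i A * x A), 0) : (Fin n → ℝ) × (Fin m → ℝ)) =
      ∑ i, (∑ A, r i A * x A) • ((Pi.single i 1, 0) : (Fin n → ℝ) × (Fin m → ℝ)) := by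
    refine Prod.ext ?_ ?_
    · rw [Prod.fst_sum]
      ext j
      simp [Finset.sum_apply, Pi.single_apply]
    · simp [Prod.snd_sum]
  rw [h, map_sum]
  simp only [map_smul, smul_eq_mul, Finset.sum_mul, Finset.mul_sum]
  rw [Finset.sum_comm]
  exact Finset.sum_congr rfl fun A _ => Finset.sum_congr rfl fun i _ => by ring

/-- Hamiltonian mechanics on a (local, trivialized) skew-symmetric algebroid with anchor
`ρ` and structure functions `C^C_{AB}`: for curves `(q,p)` with `y = ∂H/∂p(q,p)` and
`q̇ = ρ(q)y`, the generalized variational principle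
`∫ ⟨(−ρ*∂H/∂q, p), X^T⟩ dt = 0` for all time-dependent sections vanishing at the
endpoints holds iff Hamilton's equations
`ṗ_A = −ρ^i_A ∂H/∂q^i − C^C_{AB} (∂H/∂p_B) p_C` hold. -/
theorem algebroid_variational_iff_hamilton (n m : ℕ)
    (ρ : (Fin n → ℝ) → Fin n → Fin m → ℝ) (hρ : ContDiff ℝ (⊤ : ℕ∞) ρ)
    (C : Fin m → Fin m → Fin m → (Fin n → ℝ) → ℝ)
    (hCsmooth : ∀ c a b, ContDiff ℝ (⊤ : ℕ∞) (C c a b))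
    (hCskew : ∀ (c a b : Fin m) (x : Fin n → ℝ), C c a b x = -C c b a x)
    (H : ((Fin n → ℝ) × (Fin m → ℝ)) → ℝ) (hH : ContDiff ℝ (⊤ : ℕ∞) H)
    (t₀ t₁ : ℝ) (ht : t₀ < t₁)
    (q : ℝ → Fin n → ℝ) (hq : ContDiff ℝ (⊤ : ℕ∞) q)
    (p : ℝ → Fin m → ℝ) (hp : ContDiff ℝ (⊤ : ℕ∞) p)
    (y : ℝ → Fin m → ℝ)
    (hy : ∀ t B, y t B = fderiv ℝ H (q t, p t) (0, Pi.single B 1))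
    (hadm : ∀ t ∈ Set.Icc t₀ t₁, deriv q t = fun i => ∑ A, ρ (q t) i A * y t A) :
    (∀ Xt : (ℝ × (Fin n → ℝ)) → (Fin m → ℝ), ContDiff ℝ (⊤ : ℕ∞) Xt →
        Xt (t₀, q t₀) = 0 → Xt (t₁, q t₁) = 0 →
        ∫ t in t₀..t₁,
          (-(fderiv ℝ H (q t, p t) ((fun i => ∑ A, ρ (q t) i A * Xt (t, q t) A), 0)) +
            ∑ c, p t c *
              (fderiv ℝ Xt (t, q t) (1, 0) c +
                fderiv ℝ Xt (t, q t) (0, fun i => ∑ A, ρ (q t) i A * y t A) c -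
                ∑ A, ∑ B, C c A B (q t) * Xt (t, q t) A * y t B)) = 0) ↔
      (∀ t ∈ Set.Icc t₀ t₁, ∀ A : Fin m,
        deriv (fun s => p s A) t =
          -(∑ i, ρ (q t) i A * fderiv ℝ H (q t, p t) (Pi.single i 1, 0)) -
            ∑ B, ∑ c, C c A B (q t) *
              fderiv ℝ H (q t, p t) (0, Pi.single B 1) * p t c) := by
  have hdH : ContDiff ℝ (⊤ : ℕ∞) fun t => fderiv ℝ H (q t, p t) :=
    (hH.fderiv_right (m := (⊤ : ℕ∞)) (by simp)).comp (hq.prodMk hp)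
  have hρi : ∀ i A, ContDiff ℝ (⊤ : ℕ∞) fun t => ρ (q t) i A := fun i A =>
    contDiff_pi.1 (contDiff_pi.1 (hρ.comp hq) i) A
  have hpA : ∀ A, ContDiff ℝ (⊤ : ℕ∞) fun t => p t A := contDiff_pi.1 hp
  have hdp : ∀ A, ContDiff ℝ (⊤ : ℕ∞) (deriv fun s => p s A) := fun A =>
    (contDiff_infty_iff_deriv.1 (hpA A)).2
  have hCq : ∀ c A B, ContDiff ℝ (⊤ : ℕ∞) fun t => C c A B (q t) := fun c A B =>
    (hCsmooth c A B).comp hq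
  have hdHv : ∀ v, ContDiff ℝ (⊤ : ℕ∞) fun t => fderiv ℝ H (q t, p t) v := fun v =>
    hdH.clm_apply contDiff_const
  let F : ℝ → Fin m → ℝ := fun t A => deriv (fun s => p s A) t +
    (∑ i, ρ (q t) i A * fderiv ℝ H (q t, p t) (Pi.single i 1, 0)) +
      ∑ B, ∑ c, C c A B (q t) * fderiv ℝ H (q t, p t) (0, Pi.single B 1) * p t c
  have hF : ContDiff ℝ (⊤ : ℕ∞) F := by
    refine contDiff_pi.2 fun A => ((hdp A).add ?_).add ?_
    · exact ContDiff.sum fun i _ => (hρi i A).mul (hdHv _)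
    · exact ContDiff.sum fun B _ => ContDiff.sum fun c _ =>
        ((hCq c A B).mul (hdHv _)).mul (hpA c)
  have key : ∀ Xt : (ℝ × (Fin n → ℝ)) → (Fin m → ℝ), ContDiff ℝ (⊤ : ℕ∞) Xt →
      Xt (t₀, q t₀) = 0 → Xt (t₁, q t₁) = 0 →
      ∫ t in t₀..t₁,
          (-(fderiv ℝ H (q t, p t) ((fun i => ∑ A, ρ (q t) i A * Xt (t, q t) A), 0)) +
            ∑ c, p t c *
              (fderiv ℝ Xt (t, q t) (1, 0) c +
                fderiv ℝ Xt (t, q t) (0, fun i => ∑ A, ρ (q t) i A * y t A) c -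
                ∑ A, ∑ B, C c A B (q t) * Xt (t, q t) A * y t B)) =
        -∫ t in t₀..t₁, ∑ A, Xt (t, q t) A * F t A := by
    intro Xt hX h0 h1
    have hx : ContDiff ℝ (⊤ : ℕ∞) fun t => Xt (t, q t) := hX.comp (contDiff_id.prodMk hq)
    have hxA : ∀ A, ContDiff ℝ (⊤ : ℕ∞) fun t => Xt (t, q t) A := contDiff_pi.1 hx
    let P : ℝ → ℝ := fun t => ∑ A, p t A * Xt (t, q t) A
    have hP : ContDiff ℝ (⊤ : ℕ∞) P := ContDiff.sum fun A _ => (hpA A).mul (hxA A)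
    have hPd : Differentiable ℝ P := (contDiff_infty_iff_deriv.1 hP).1
    have hPc : Continuous (deriv P) := (contDiff_infty_iff_deriv.1 hP).2.continuous
    have hGc : Continuous fun t => ∑ A, Xt (t, q t) A * F t A :=
      continuous_finsetSum _ fun A _ => (hxA A).continuous.mul
        ((continuous_apply A).comp hF.continuous)
    have hintP : ∫ t in t₀..t₁, deriv P t = 0 := by
      rw [intervalIntegral.integral_deriv_eq_sub (fun t _ => hPd t)
        (hPc.intervalIntegrable _ _)]
      simp [P, h0, h1]
    have hdiff : (∫ t in t₀..t₁, deriv P t) - ∫ t in t₀..t₁, ∑ A, Xt (t, q t) A * F t A =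
        -∫ t in t₀..t₁, ∑ A, Xt (t, q t) A * F t A := by rw [hintP, zero_sub]
    rw [← hdiff, ← intervalIntegral.integral_sub (hPc.intervalIntegrable _ _)
      (hGc.intervalIntegrable _ _)]
    refine intervalIntegral.integral_congr fun t htm => ?_
    rw [Set.uIcc_of_le ht.le] at htm
    have hqd : HasDerivAt q (deriv q t) t := (hq.differentiable (by simp) t).hasDerivAt
    have hxd : HasDerivAt (fun s => Xt (s, q s)) (fderiv ℝ Xt (t, q t) (1, deriv q t)) t :=
      ((hX.differentiable (by simp) (t, q t)).hasFDerivAt).comp_hasDerivAt t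
        ((hasDerivAt_id t).prodMk hqd)
    have hxdA := hasDerivAt_pi.1 hxd
    have hPt : deriv P t = ∑ A, (deriv (fun s => p s A) t * Xt (t, q t) A +
        p t A * fderiv ℝ Xt (t, q t) (1, deriv q t) A) :=
      (HasDerivAt.fun_sum fun A _ =>
        (((hpA A).differentiable (by simp) t).hasDerivAt).mul (hxdA A)).deriv
    have hsplit : fderiv ℝ Xt (t, q t) (1, deriv q t) =
        fderiv ℝ Xt (t, q t) (1, 0) +
          fderiv ℝ Xt (t, q t) (0, fun i => ∑ A, ρ (q t) i A * y t A) := by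
      rw [← map_add, hadm t htm]
      simp
    have hbr : ∑ c, p t c * ∑ A, ∑ B, C c A B (q t) * Xt (t, q t) A * y t B =
        ∑ A, Xt (t, q t) A * ∑ B, ∑ c, C c A B (q t) *
          fderiv ℝ H (q t, p t) (0, Pi.single B 1) * p t c := by
      simp only [← hy, Finset.mul_sum]
      rw [Finset.sum_comm]
      refine Finset.sum_congr rfl fun A _ => ?_
      rw [Finset.sum_comm]
      exact Finset.sum_congr rfl fun B _ => Finset.sum_congr rfl fun c _ => by ring
    simp only [hPt, hsplit, map_anchor_eq_sum, mul_sub, Finset.sum_sub_distrib, hbr, F, mul_add,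
      Finset.sum_add_distrib, Pi.add_apply]
    simp only [mul_comm (Xt (t, q t) _) (deriv _ _)]
    ring
  have hiff : ∀ t A, F t A = 0 ↔ deriv (fun s => p s A) t =
      -(∑ i, ρ (q t) i A * fderiv ℝ H (q t, p t) (Pi.single i 1, 0)) -
        ∑ B, ∑ c, C c A B (q t) *
          fderiv ℝ H (q t, p t) (0, Pi.single B 1) * p t c := by
    intro t A
    rw [eq_sub_iff_add_eq, eq_neg_iff_add_eq_zero, add_right_comm]
  constructor
  · intro h t htm A
    have hX : ContDiff ℝ (⊤ : ℕ∞) fun z : ℝ × (Fin n → ℝ) =>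
        ((z.1 - t₀) * (t₁ - z.1)) • F z.1 :=
      ((contDiff_fst.sub contDiff_const).mul (contDiff_const.sub contDiff_fst)).smul
        (hF.comp contDiff_fst)
    have hvar := h _ hX (by simp) (by simp)
    rw [key _ hX (by simp) (by simp), neg_eq_zero] at hvar
    simp only [Pi.smul_apply, smul_eq_mul] at hvar
    exact (hiff t A).1
      (congrFun (eq_zero_of_integral_weighted_sum_sq_eq_zero ht hF.continuous hvar t htm) A)
  · intro h Xt hX h0 h1
    rw [key Xt hX h0 h1, neg_eq_zero]
    refine (intervalIntegral.integral_congr fun t htm => ?_).trans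
      intervalIntegral.integral_zero
    rw [Set.uIcc_of_le ht.le] at htm
    exact Finset.sum_eq_zero fun A _ => by rw [(hiff t A).2 (h t htm A), mul_zero]
end

section
/- Let E be a real normed vector space, let L_d : E × E → ℝ be differentiable, let N ≥ 2, and let σ : {0,…,N} → E. Then the following are equivalent: (a) for every sequence x : {0,…,N} → E with x₀ = 0 and x_N = 0, Σ_{k=0}^{N−1} [ D₁L_d(σ_k, σ_{k+1})(x_k) + D₂L_d(σ_k, σ_{k+1})(x_{k+1}) ] = 0; (b) σ satisfies the discrete Euler–Lagrange equations: D₁L_d(σ_k, σ_{k+1}) + D₂L_d(σ_{k−1}, σ_k) = 0 as linear functionals on E, for all k with 1 ≤ k ≤ N−1. -/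
/-- Discrete summation by parts: regroup the terms of a sum by shifting the first summand. -/
theorem Finset.sum_range_succ_add_shift {M : Type*} [AddCommMonoid M] (f g : ℕ → M) (n : ℕ) :
    ∑ k ∈ Finset.range (n + 1), (f k + g k) =
      ∑ k ∈ Finset.range n, (f (k + 1) + g k) + (f 0 + g n) := by
  rw [Finset.sum_add_distrib, Finset.sum_range_succ' f, Finset.sum_range_succ g,
    Finset.sum_add_distrib]
  exact add_add_add_comm _ _ _ _

/-- Discrete Hamilton's principle: a discrete curve `σ` satisfies
`Σ_{k=0}^{N−1} [D₁L_d(σ_k,σ_{k+1})(x_k) + D₂L_d(σ_k,σ_{k+1})(x_{k+1})] = 0` for all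
variations `x` with `x₀ = x_N = 0` iff it satisfies the discrete Euler–Lagrange
equations `D₁L_d(σ_k,σ_{k+1}) + D₂L_d(σ_{k−1},σ_k) = 0` for `1 ≤ k ≤ N−1`. -/
theorem discrete_variational_iff_discrete_euler_lagrange
    (E : Type*) [NormedAddCommGroup E] [NormedSpace ℝ E]
    (Ld : E × E → ℝ) (hLd : Differentiable ℝ Ld)
    (N : ℕ) (hN : 2 ≤ N) (σ : ℕ → E) :
    (∀ x : ℕ → E, x 0 = 0 → x N = 0 →
        ∑ k ∈ Finset.range N,
          (fderiv ℝ Ld (σ k, σ (k + 1)) (x k, 0) +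
            fderiv ℝ Ld (σ k, σ (k + 1)) (0, x (k + 1))) = 0) ↔
      (∀ k : ℕ, 1 ≤ k → k ≤ N - 1 → ∀ w : E,
        fderiv ℝ Ld (σ k, σ (k + 1)) (w, 0) +
          fderiv ℝ Ld (σ (k - 1), σ k) (0, w) = 0) := by
  obtain ⟨n, rfl⟩ : ∃ n, N = n + 1 := ⟨N - 1, by omega⟩
  have sum_eq (x : ℕ → E) (h0 : x 0 = 0) (hn : x (n + 1) = 0) :
      ∑ k ∈ Finset.range (n + 1),
          (fderiv ℝ Ld (σ k, σ (k + 1)) (x k, 0) +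
            fderiv ℝ Ld (σ k, σ (k + 1)) (0, x (k + 1))) =
        ∑ k ∈ Finset.range n,
          (fderiv ℝ Ld (σ (k + 1), σ (k + 1 + 1)) (x (k + 1), 0) +
            fderiv ℝ Ld (σ k, σ (k + 1)) (0, x (k + 1))) := by
    rw [Finset.sum_range_succ_add_shift (fun k ↦ fderiv ℝ Ld (σ k, σ (k + 1)) (x k, 0))
      (fun k ↦ fderiv ℝ Ld (σ k, σ (k + 1)) (0, x (k + 1)))]
    simp [h0, hn, ← Prod.zero_eq_mk]
  constructor
  · intro h k hk hkn w
    obtain ⟨j, rfl⟩ : ∃ j, k = j + 1 := ⟨k - 1, by omega⟩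
    have h0 : Pi.single (M := fun _ ↦ E) (j + 1) w 0 = 0 :=
      Pi.single_eq_of_ne (M := fun _ ↦ E) (Nat.succ_ne_zero j).symm w
    have hn : Pi.single (M := fun _ ↦ E) (j + 1) w (n + 1) = 0 :=
      Pi.single_eq_of_ne (M := fun _ ↦ E) (show n + 1 ≠ j + 1 by omega) w
    have key := h _ h0 hn
    rw [sum_eq _ h0 hn, Finset.sum_eq_single_of_mem j (Finset.mem_range.2 (by omega))] at key
    · simpa using key
    · intro i _ hij
      rw [Pi.single_eq_of_ne (M := fun _ ↦ E) (show i + 1 ≠ j + 1 by omega) w]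
      simp [← Prod.zero_eq_mk]
  · intro h x h0 hn
    rw [sum_eq x h0 hn]
    refine Finset.sum_eq_zero fun k hk ↦ ?_
    have hkn := Finset.mem_range.1 hk
    simpa using h (k + 1) (by omega) (by omega) (x (k + 1))
end

section
/- Let E be a real normed vector space, let L_d : E × E → ℝ and Φ = (Φ¹,…,Φᵐ) : E × E → ℝᵐ be differentiable, let N ≥ 2, let σ : {0,…,N} → E satisfy Φ^α(σ_k, σ_{k+1}) = 0 for all 0 ≤ k ≤ N−1 and all α, let c⁰,…,c^{N−1} ∈ ℝᵐ, and for 0 ≤ k ≤ N−1 let μ(k) = dL_d(σ_k,σ_{k+1}) + Σ_α c^k_α dΦ^α(σ_k,σ_{k+1}). Then the following are equivalent: (a) for every sequence x : {0,…,N} → E with x₀ = 0 and x_N = 0, Σ_{k=0}^{N−1} ⟨μ(k), (x_k, x_{k+1})⟩ = 0; (b) the discrete constrained Euler–Lagrange equations hold: for all 1 ≤ k ≤ N−1, D₁L_d(σ_k, σ_{k+1}) + Σ_α c^k_α D₁Φ^α(σ_k, σ_{k+1}) + D₂L_d(σ_{k−1}, σ_k) + Σ_α c^{k−1}_α D₂Φ^α(σ_{k−1},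 σ_k) = 0 as linear functionals on E. -/
/-- Discrete integration by parts: if `x` vanishes at both endpoints, the sum of the pairings
`⟨μ k, (x k, x (k + 1))⟩` only involves the interior points of `x`. -/
lemma sum_pairing_eq_sum_interior {R M P : Type*} [Semiring R] [AddCommMonoid M] [Module R M]
    [AddCommMonoid P] [Module R P] (μ : ℕ → M × M →ₗ[R] P) (n : ℕ) (x : ℕ → M)
    (h₀ : x 0 = 0) (hn : x (n + 1) = 0) :
    ∑ k ∈ Finset.range (n + 1), μ k (x k, x (k + 1)) =
      ∑ k ∈ Finset.range n, (μ (k + 1) (x (k + 1), 0) + μ k (0, x (k + 1))) := by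
  have split (k : ℕ) : μ k (x k, x (k + 1)) = μ k (x k, 0) + μ k (0, x (k + 1)) := by
    rw [← map_add, Prod.mk_add_mk, add_zero, zero_add]
  have zero (k : ℕ) : μ k (0, 0) = 0 := map_zero (μ k)
  simp_rw [split]
  rw [Finset.sum_add_distrib, Finset.sum_range_succ', Finset.sum_range_succ (fun k => μ k (0, _)),
    h₀, hn, zero, zero, add_zero, add_zero, Finset.sum_add_distrib]

/-- The fundamental lemma of the discrete calculus of variations. -/
lemma sum_pairing_eq_zero_iff {R M P : Type*} [Semiring R] [AddCommMonoid M] [Module R M]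
    [AddCommMonoid P] [Module R P] (μ : ℕ → M × M →ₗ[R] P) (n : ℕ) :
    (∀ x : ℕ → M, x 0 = 0 → x (n + 1) = 0 →
        ∑ k ∈ Finset.range (n + 1), μ k (x k, x (k + 1)) = 0) ↔
      ∀ k < n, ∀ w : M, μ (k + 1) (w, 0) + μ k (0, w) = 0 := by
  constructor
  · intro h k hk w
    have h₀ : Pi.single (M := fun _ : ℕ => M) (k + 1) w 0 = 0 :=
      Pi.single_eq_of_ne (Nat.succ_ne_zero k).symm w
    have hn : Pi.single (M := fun _ : ℕ => M) (k + 1) w (n + 1) = 0 := by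
      rw [Pi.single_eq_of_ne (by omega)]
    have key := h _ h₀ hn
    rw [sum_pairing_eq_sum_interior μ n _ h₀ hn, Finset.sum_eq_single_of_mem k
      (Finset.mem_range.2 hk)] at key
    · simpa using key
    · intro j _ hj
      rw [Pi.single_eq_of_ne (fun h => hj (Nat.succ_injective h)), Prod.mk_zero_zero, map_zero, map_zero, add_zero]
  · intro h x h₀ hn
    rw [sum_pairing_eq_sum_interior μ n x h₀ hn]
    exact Finset.sum_eq_zero fun k hk => h k (Finset.mem_range.1 hk) _


/-- Discrete constrained variational calculus: for a discrete curve `σ` satisfying the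
discrete constraints `Φ^α(σ_k, σ_{k+1}) = 0` and multipliers `c^k ∈ ℝᵐ`, the discrete
generalized variational principle with covectors
`μ(k) = dL_d(σ_k,σ_{k+1}) + Σ_α c^k_α dΦ^α(σ_k,σ_{k+1})` holds for all variations
vanishing at the endpoints iff the discrete constrained Euler–Lagrange equations hold
for `1 ≤ k ≤ N−1`. -/
theorem discrete_constrained_variational_iff_euler_lagrange
    (E : Type*) [NormedAddCommGroup E] [NormedSpace ℝ E] (m : ℕ)
    (Ld : E × E → ℝ) (hLd : Differentiable ℝ Ld)
    (Φ : E × E → Fin m → ℝ) (hΦ : Differentiable ℝ Φ)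
    (N : ℕ) (hN : 2 ≤ N) (σ : ℕ → E)
    (hcon : ∀ k < N, ∀ α, Φ (σ k, σ (k + 1)) α = 0)
    (c : ℕ → Fin m → ℝ) :
    (∀ x : ℕ → E, x 0 = 0 → x N = 0 →
        ∑ k ∈ Finset.range N,
          (fderiv ℝ Ld (σ k, σ (k + 1)) (x k, x (k + 1)) +
            ∑ α, c k α *
              fderiv ℝ (fun z : E × E => Φ z α) (σ k, σ (k + 1))
                (x k, x (k + 1))) = 0) ↔
      (∀ k : ℕ, 1 ≤ k → k ≤ N - 1 → ∀ w : E,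
        fderiv ℝ Ld (σ k, σ (k + 1)) (w, 0) +
          (∑ α, c k α * fderiv ℝ (fun z : E × E => Φ z α) (σ k, σ (k + 1)) (w, 0)) +
          fderiv ℝ Ld (σ (k - 1), σ k) (0, w) +
          (∑ α, c (k - 1) α *
            fderiv ℝ (fun z : E × E => Φ z α) (σ (k - 1), σ k) (0, w)) = 0) := by
  obtain ⟨n, rfl⟩ : ∃ n, N = n + 1 := ⟨N - 1, by omega⟩
  let μ (k : ℕ) : E × E →ₗ[ℝ] ℝ :=
    (fderiv ℝ Ld (σ k, σ (k + 1)) +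
      ∑ α, c k α • fderiv ℝ (fun z : E × E => Φ z α) (σ k, σ (k + 1))).toLinearMap
  have hμ (k : ℕ) (v : E × E) : μ k v = fderiv ℝ Ld (σ k, σ (k + 1)) v +
      ∑ α, c k α * fderiv ℝ (fun z : E × E => Φ z α) (σ k, σ (k + 1)) v := by
    simp [μ]
  have key := sum_pairing_eq_zero_iff μ n
  simp only [hμ, ← add_assoc] at key
  refine key.trans ⟨fun h k hk hkn w => ?_, fun h k hk w => ?_⟩
  · obtain ⟨j, rfl⟩ : ∃ j, k = j + 1 := ⟨k - 1, by omega⟩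
    exact h j (by omega) w
  · exact h (k + 1) (by omega) (by omega) w
end
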